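/- arXiv:1910.13161 — 2 statements merged into one kernel-verified Lean document; each statement's English description precedes it below -/
import Mathlib

section
/- Let H be a finite-dimensional Hopf algebra over a field k of characteristic zero with the Chevalley property, with Jacobson radical J and quotient map π : H → H/J. Then the regular character of H satisfies χ_H = (dim(H)/dim(H/J)) · (χ_{H/J} ∘ π). -/
/-- The character (trace) of the left regular representation of a finite-dimensional
`k`-algebra `H`: the functional `h ↦ tr(x ↦ h * x)`. -/
noncomputable def regChar (k H : Type*) [Field k] [Ring H] [Algebra k H]
    [FiniteDimensional k H] : Module.Dual k H :=
  (LinearMap.trace k H) ∘ₗ (LinearMap.mul k H)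

namespace S17
open TensorProduct Coalgebra
section
variable {k H M : Type*} [Field k] [Ring H] [HopfAlgebra k H] [AddCommGroup M] [Module k M]

/-- a ⊗ b ↦ f a * g b -/
noncomputable def cv (f g : Module.Dual k H) : Module.Dual k H :=
  LinearMap.mul' k k ∘ₗ TensorProduct.map f g ∘ₗ comul

/-- `x ⊗ m ↦ x₁ ⊗ f x₂ m` -/
noncomputable def Psi (f : H →ₗ[k] Module.End k M) : (H ⊗[k] H) ⊗[k] M →ₗ[k] H ⊗[k] M :=
  LinearMap.lTensor H (TensorProduct.lift f) ∘ₗ (TensorProduct.assoc k H H M).toLinearMap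

lemma Psi_tmul (f : H →ₗ[k] Module.End k M) (a b : H) (m : M) :
    Psi f ((a ⊗ₜ b) ⊗ₜ m) = a ⊗ₜ f b m := by simp [Psi]

noncomputable def Phi (f : H →ₗ[k] Module.End k M) : H ⊗[k] M →ₗ[k] H ⊗[k] M :=
  Psi f ∘ₗ LinearMap.rTensor M comul

lemma Phi_tmul (f : H →ₗ[k] Module.End k M) (a : H) (m : M) :
    Phi f (a ⊗ₜ m) = Psi f (comul a ⊗ₜ m) := by simp [Phi]

noncomputable def Theta (f g : H →ₗ[k] Module.End k M) (m : M) :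
    H ⊗[k] (H ⊗[k] H) →ₗ[k] H ⊗[k] M :=
  LinearMap.lTensor H ((LinearMap.applyₗ m) ∘ₗ LinearMap.mul' k (Module.End k M) ∘ₗ
    TensorProduct.map f g)

lemma Phi_comp (f g : H →ₗ[k] Module.End k M)
    (h : ∀ x : H, LinearMap.mul' k _ (TensorProduct.map f g (comul x)) =
      algebraMap k _ (counit x)) :
    Phi f * Phi g = 1 := by
  apply TensorProduct.ext'
  intro x m
  have h1 : ∀ t : H ⊗[k] H, Phi f (Psi g (t ⊗ₜ m)) =
      Theta f g m (TensorProduct.assoc k H H H (LinearMap.rTensor H comul t)) := by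
    intro t
    induction t with
    | zero => simp
    | add x y hx hy => simp only [add_tmul, map_add, hx, hy]
    | tmul a b =>
      rw [Psi_tmul, Phi_tmul, LinearMap.rTensor_tmul]
      generalize (comul a : H ⊗[k] H) = s
      induction s with
      | zero => simp
      | add x y hx hy => simp only [add_tmul, map_add, hx, hy]
      | tmul c d => simp [Psi_tmul, Theta]
  have h2 : ∀ t : H ⊗[k] H, Theta f g m (LinearMap.lTensor H comul t) =
      TensorProduct.lift ((TensorProduct.mk k H M).flip.comp (LinearMap.toSpanSingleton k M m)).flip
        (LinearMap.lTensor H counit t) := by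
    intro t
    induction t with
    | zero => simp
    | add x y hx hy => simp only [map_add, hx, hy]
    | tmul a b => simp [Theta, h]
  simp [Phi_tmul, h1, h2]

lemma trT (A B : Type*) [AddCommGroup A] [Module k A] [FiniteDimensional k A]
    [AddCommGroup B] [Module k B] [FiniteDimensional k B]
    (f : H →ₗ[k] Module.End k A) (g : H →ₗ[k] Module.End k B) (t : H ⊗[k] H) :
    LinearMap.trace k (A ⊗[k] B) (TensorProduct.homTensorHomMap (.id k) A B A B
      (TensorProduct.map f g t)) =
    LinearMap.mul' k k (TensorProduct.map (LinearMap.trace k A ∘ₗ f) (LinearMap.trace k B ∘ₗ g) t) := by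
  induction t with
  | zero => simp
  | add x y hx hy => simp only [map_add, hx, hy]
  | tmul a b => simp [LinearMap.trace_tensorProduct']

lemma leftL [FiniteDimensional k H] [FiniteDimensional k M] (ρ : H →ₐ[k] Module.End k M) :
    cv (LinearMap.trace k H ∘ₗ LinearMap.mul k H) (LinearMap.trace k M ∘ₗ ρ.toLinearMap) =
    (Module.finrank k M : k) • (LinearMap.trace k H ∘ₗ LinearMap.mul k H) := by
  ext h
  have hGF : Phi (ρ.toLinearMap ∘ₗ HopfAlgebra.antipode k) * Phi ρ.toLinearMap = 1 := by
    apply Phi_comp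
    intro x
    have := congrArg ρ (HopfAlgebra.mul_antipode_rTensor_comul_apply (R := k) x)
    rw [AlgHom.commutes] at this
    rw [← this]
    generalize (comul x : H ⊗[k] H) = s
    induction s with
    | zero => simp
    | add x y hx hy => simp only [map_add, hx, hy]
    | tmul c d => simp
  have hFG := mul_eq_one_comm.mp hGF
  set F := Phi ρ.toLinearMap
  set G := Phi (ρ.toLinearMap ∘ₗ HopfAlgebra.antipode k)
  set T := TensorProduct.homTensorHomMap (.id k) H M H M
      (TensorProduct.map (LinearMap.mul k H) ρ.toLinearMap (comul h)) with hT
  have key : T * F = F * LinearMap.rTensor M (LinearMap.mul k H h) := by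
    apply TensorProduct.ext'
    intro x m
    simp only [Module.End.mul_apply, LinearMap.rTensor_tmul, LinearMap.mul_apply_apply, F, Phi_tmul,
      Bialgebra.comul_mul, hT]
    generalize (comul h : H ⊗[k] H) = t
    generalize (comul x : H ⊗[k] H) = s
    induction t with
    | zero => simp
    | add x y hx hy => simp only [map_add, hx, hy, add_mul, add_tmul, LinearMap.add_apply]
    | tmul a b =>
      induction s with
      | zero => simp
      | add x y hx hy => simp only [map_add, hx, hy, mul_add, add_tmul]
      | tmul c d => simp [Psi_tmul]
  have e : LinearMap.trace k _ T = LinearMap.trace k _ (LinearMap.rTensor M (LinearMap.mul k H h)) := by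
    calc _ = LinearMap.trace k _ (T * F * G) := by rw [mul_assoc, hFG, mul_one]
      _ = _ := by rw [key, LinearMap.trace_mul_comm, ← mul_assoc, hGF, one_mul]
  rw [hT, trT, LinearMap.rTensor, LinearMap.trace_tensorProduct', LinearMap.trace_id] at e
  simpa [cv, mul_comm] using e
end
section
variable {k H M : Type*} [Field k] [Ring H] [HopfAlgebra k H] [AddCommGroup M] [Module k M]

/-- `m ⊗ (a ⊗ b) ↦ f a m ⊗ b` -/
noncomputable def Psi' (f : H →ₗ[k] Module.End k M) : M ⊗[k] (H ⊗[k] H) →ₗ[k] M ⊗[k] H :=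
  LinearMap.rTensor H (TensorProduct.lift f.flip) ∘ₗ (TensorProduct.assoc k M H H).symm.toLinearMap

lemma Psi'_tmul (f : H →ₗ[k] Module.End k M) (a b : H) (m : M) :
    Psi' f (m ⊗ₜ (a ⊗ₜ b)) = f a m ⊗ₜ b := by simp [Psi']

noncomputable def Phi' (f : H →ₗ[k] Module.End k M) : M ⊗[k] H →ₗ[k] M ⊗[k] H :=
  Psi' f ∘ₗ LinearMap.lTensor M comul

lemma Phi'_tmul (f : H →ₗ[k] Module.End k M) (a : H) (m : M) :
    Phi' f (m ⊗ₜ a) = Psi' f (m ⊗ₜ comul a) := by simp [Phi']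

noncomputable def Theta' (f g : H →ₗ[k] Module.End k M) (m : M) :
    (H ⊗[k] H) ⊗[k] H →ₗ[k] M ⊗[k] H :=
  LinearMap.rTensor H ((LinearMap.applyₗ m) ∘ₗ LinearMap.mul' k (Module.End k M) ∘ₗ
    TensorProduct.map f g ∘ₗ (TensorProduct.comm k H H).toLinearMap)

lemma Phi'_comp (f g : H →ₗ[k] Module.End k M)
    (h : ∀ x : H, LinearMap.mul' k _ (TensorProduct.map f g (TensorProduct.comm k H H (comul x))) =
      algebraMap k _ (counit x)) :
    Phi' f * Phi' g = 1 := by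
  apply TensorProduct.ext'
  intro m x
  have h1 : ∀ t : H ⊗[k] H, Phi' f (Psi' g (m ⊗ₜ t)) =
      Theta' f g m ((TensorProduct.assoc k H H H).symm (LinearMap.lTensor H comul t)) := by
    intro t
    induction t with
    | zero => simp
    | add x y hx hy => simp only [tmul_add, map_add, hx, hy]
    | tmul a b =>
      rw [Psi'_tmul, Phi'_tmul, LinearMap.lTensor_tmul]
      generalize (comul b : H ⊗[k] H) = s
      induction s with
      | zero => simp
      | add x y hx hy => simp only [tmul_add, map_add, hx, hy]
      | tmul c d => simp [Psi'_tmul, Theta']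
  have h2 : ∀ t : H ⊗[k] H, Theta' f g m (LinearMap.rTensor H comul t) =
      TensorProduct.lift ((TensorProduct.mk k M H).comp (LinearMap.toSpanSingleton k M m))
        (LinearMap.rTensor H counit t) := by
    intro t
    induction t with
    | zero => simp
    | add x y hx hy => simp only [map_add, hx, hy]
    | tmul a b => simp [Theta', h, smul_tmul']
  simp [Phi'_tmul, h1, h2]

lemma rightR [FiniteDimensional k H] [FiniteDimensional k M] (ρ : H →ₗ[k] Module.End k M)
    (hone : ρ 1 = 1) (hmul : ∀ a b, ρ (a * b) = ρ b * ρ a) :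
    cv (LinearMap.trace k M ∘ₗ ρ) (LinearMap.trace k H ∘ₗ (LinearMap.mul k H).flip) =
    (Module.finrank k M : k) • (LinearMap.trace k H ∘ₗ (LinearMap.mul k H).flip) := by
  ext h
  have hGF : Phi' (ρ ∘ₗ HopfAlgebra.antipode k) * Phi' ρ = 1 := by
    apply Phi'_comp
    intro x
    have := congrArg ρ (HopfAlgebra.mul_antipode_lTensor_comul_apply (R := k) x)
    rw [Algebra.algebraMap_eq_smul_one, map_smul, hone, ← Algebra.algebraMap_eq_smul_one] at this
    rw [← this]
    generalize (comul x : H ⊗[k] H) = s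
    induction s with
    | zero => simp
    | add x y hx hy => simp only [map_add, hx, hy]
    | tmul c d => simp [hmul]
  have hFG := mul_eq_one_comm.mp hGF
  set F := Phi' ρ
  set G := Phi' (ρ ∘ₗ HopfAlgebra.antipode k)
  set T := TensorProduct.homTensorHomMap (.id k) M H M H
      (TensorProduct.map ρ (LinearMap.mul k H).flip (comul h)) with hT
  have key : T * F = F * LinearMap.lTensor M ((LinearMap.mul k H).flip h) := by
    apply TensorProduct.ext'
    intro m x
    simp only [Module.End.mul_apply, LinearMap.lTensor_tmul, LinearMap.flip_apply,
      LinearMap.mul_apply_apply, F, Phi'_tmul, Bialgebra.comul_mul, hT]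
    generalize (comul h : H ⊗[k] H) = t
    generalize (comul x : H ⊗[k] H) = s
    induction t with
    | zero => simp
    | add x y hx hy => simp only [map_add, hx, hy, mul_add, tmul_add, LinearMap.add_apply]
    | tmul a b =>
      induction s with
      | zero => simp
      | add x y hx hy => simp only [map_add, hx, hy, add_mul, tmul_add]
      | tmul c d => simp [Psi'_tmul, hmul]
  have e : LinearMap.trace k _ T =
      LinearMap.trace k _ (LinearMap.lTensor M ((LinearMap.mul k H).flip h)) := by
    calc _ = LinearMap.trace k _ (T * F * G) := by rw [mul_assoc, hFG, mul_one]
      _ = _ := by rw [key, LinearMap.trace_mul_comm, ← mul_assoc, hGF, one_mul]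
  rw [hT, trT, LinearMap.lTensor, LinearMap.trace_tensorProduct', LinearMap.trace_id] at e
  simpa [cv] using e

lemma finrank_ne [CharZero k] [FiniteDimensional k H] : (Module.finrank k H : k) ≠ 0 := by
  have : Nontrivial H := by
    refine ⟨1, 0, fun h => ?_⟩
    have := congrArg (counit (R := k)) h
    simp at this
  exact_mod_cast Module.finrank_pos.ne'

lemma tr_dual [FiniteDimensional k M] (f : H →ₗ[k] Module.End k M) :
    LinearMap.trace k (Module.Dual k M) ∘ₗ (Module.Dual.transpose ∘ₗ f) =
      LinearMap.trace k M ∘ₗ f := by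
  rw [← LinearMap.comp_assoc, LinearMap.trace_transpose]

lemma left_eq_right [CharZero k] [FiniteDimensional k H] :
    LinearMap.trace k H ∘ₗ LinearMap.mul k H = LinearMap.trace k H ∘ₗ (LinearMap.mul k H).flip := by
  have h1 := leftL (k := k) (H := H) (M := Module.Dual k H)
    (AlgHom.ofLinearMap (Module.Dual.transpose ∘ₗ (LinearMap.mul k H).flip)
      (by ext; simp [Module.Dual.transpose]) (by intros; ext; simp [Module.Dual.transpose, mul_assoc]))
  have h2 := rightR (k := k) (H := H) (M := Module.Dual k H)
    (Module.Dual.transpose ∘ₗ (LinearMap.mul k H))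
      (by ext; simp [Module.Dual.transpose]) (by intros; ext; simp [Module.Dual.transpose, mul_assoc])
  rw [AlgHom.toLinearMap_ofLinearMap, tr_dual] at h1
  rw [tr_dual, h1] at h2
  rw [Subspace.dual_finrank_eq] at h2
  exact smul_right_injective _ finrank_ne h2

/-- `χ_M * χ_H = dim M • χ_H` -/
lemma rightL [CharZero k] [FiniteDimensional k H] [FiniteDimensional k M]
    (ρ : H →ₐ[k] Module.End k M) :
    cv (LinearMap.trace k M ∘ₗ ρ.toLinearMap) (LinearMap.trace k H ∘ₗ LinearMap.mul k H) =
    (Module.finrank k M : k) • (LinearMap.trace k H ∘ₗ LinearMap.mul k H) := by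
  have h2 := rightR (k := k) (H := H) (M := Module.Dual k M)
    (Module.Dual.transpose ∘ₗ ρ.toLinearMap)
      (by ext; simp [Module.Dual.transpose]) (by intros; ext; simp [Module.Dual.transpose])
  rw [tr_dual, Subspace.dual_finrank_eq] at h2
  rw [left_eq_right, h2]

lemma trace_add {V W U : Type*} [AddCommGroup V] [Module k V] [FiniteDimensional k V]
    [AddCommGroup W] [Module k W] [FiniteDimensional k W]
    [AddCommGroup U] [Module k U] [FiniteDimensional k U]
    (i : W →ₗ[k] V) (p : V →ₗ[k] U) (hi : Function.Injective i) (hp : Function.Surjective p)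
    (hex : Function.Exact i p) (f : Module.End k V) (fW : Module.End k W) (fU : Module.End k U)
    (h1 : f ∘ₗ i = i ∘ₗ fW) (h2 : p ∘ₗ f = fU ∘ₗ p) :
    LinearMap.trace k V f = LinearMap.trace k W fW + LinearMap.trace k U fU := by
  obtain ⟨s, hs⟩ := p.exists_rightInverse_of_surjective (LinearMap.range_eq_top.mpr hp)
  obtain ⟨r, hr⟩ := i.exists_leftInverse_of_injective (LinearMap.ker_eq_bot.mpr hi)
  have hs' : ∀ x, p (s x) = x := fun x => LinearMap.congr_fun hs x
  have hr' : ∀ x, r (i x) = x := fun x => LinearMap.congr_fun hr x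
  -- decompose the identity
  have hid : f = f ∘ₗ (i ∘ₗ (r - r ∘ₗ s ∘ₗ p)) + f ∘ₗ (s ∘ₗ p) := by
    ext v
    obtain ⟨w, hw⟩ := (hex (v - s (p v))).mp (by simp [hs'])
    have : v = i (r (v - s (p v))) + s (p v) := by rw [← hw, hr', hw]; abel
    simp only [LinearMap.add_apply, LinearMap.comp_apply, LinearMap.sub_apply]
    rw [← map_add, ← map_sub, ← this]
  have hpi : p ∘ₗ i = 0 := by ext w; exact hex.apply_apply_eq_zero w
  rw [hid, map_add, ← LinearMap.comp_assoc, h1, LinearMap.comp_assoc, ]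
  congr 1
  · rw [← LinearMap.comp_assoc, LinearMap.trace_comp_comm']
    congr 1
    ext w
    have := LinearMap.congr_fun hpi (fW w)
    simp only [LinearMap.comp_apply, LinearMap.zero_apply] at this
    simp [hr', this]
  · rw [← LinearMap.comp_assoc, LinearMap.trace_comp_comm', ← LinearMap.comp_assoc, h2,
      LinearMap.comp_assoc, hs, LinearMap.comp_id]
end
section
universe u v w x
variable {k : Type u} {H : Type v} {Q : Type w} [Field k] [CharZero k]
  [Ring H] [HopfAlgebra k H] [FiniteDimensional k H]
  [Ring Q] [HopfAlgebra k Q] [FiniteDimensional k Q]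

lemma cv_comp (π : H →ₐc[k] Q) (f g : Module.Dual k Q) :
    cv (f ∘ₗ (π : H →ₗ[k] Q)) (g ∘ₗ (π : H →ₗ[k] Q)) = cv f g ∘ₗ (π : H →ₗ[k] Q) := by
  ext h
  have := CoalgHomClass.map_comp_comul_apply π h
  simp only [cv, LinearMap.comp_apply, TensorProduct.map_comp]
  congr 2

lemma cv_add (f g h : Module.Dual k H) : cv (f + g) h = cv f h + cv g h := by
  simp [cv, TensorProduct.map_add_left, LinearMap.comp_add, LinearMap.add_comp]

/-- modules killed by the kernel -/
lemma killed (π : H →ₐc[k] Q) (hsurj : Function.Surjective π)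
    (M : Type x) [AddCommGroup M] [Module k M] [FiniteDimensional k M]
    (ρ : H →ₐ[k] Module.End k M) (hk : ∀ h, π h = 0 → ρ h = 0) :
    cv (LinearMap.trace k M ∘ₗ ρ.toLinearMap)
      ((LinearMap.trace k Q ∘ₗ LinearMap.mul k Q) ∘ₗ (π : H →ₗ[k] Q)) =
    (Module.finrank k M : k) •
      ((LinearMap.trace k Q ∘ₗ LinearMap.mul k Q) ∘ₗ (π : H →ₗ[k] Q)) := by
  have hw : ∀ a b, π a = π b → ρ a = ρ b := by
    intro a b hab
    have := hk (a - b) (by rw [map_sub, hab, sub_self])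
    rwa [map_sub, sub_eq_zero] at this
  have hs := Function.surjInv_eq hsurj
  let σ : Q →ₐ[k] Module.End k M := AlgHom.ofLinearMap
    { toFun := fun q => ρ (Function.surjInv hsurj q)
      map_add' := fun a b => by rw [← map_add]; apply hw; simp [hs]
      map_smul' := fun c a => by
        rw [RingHom.id_apply, ← map_smul]; apply hw; rw [map_smul, hs, hs] }
    (by
      change ρ _ = 1
      rw [← map_one ρ]; apply hw; simp [hs])
    (fun a b => by
      change ρ _ = ρ _ * ρ _
      rw [← map_mul]; apply hw; simp [hs])
  have hσ : ρ.toLinearMap = σ.toLinearMap ∘ₗ (π : H →ₗ[k] Q) := by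
    ext1 h
    change ρ h = ρ _
    apply hw
    rw [hs]; rfl
  rw [hσ, ← LinearMap.comp_assoc, cv_comp, rightL]
  rfl

lemma simple_case (π : H →ₐc[k] Q) (hsurj : Function.Surjective π)
    (hker : ∀ h : H, π h = 0 → h ∈ Ideal.jacobson (⊥ : Ideal H))
    (M : Type x) [AddCommGroup M] [Module k M] [Module H M] [IsScalarTower k H M]
    [FiniteDimensional k M] [IsSimpleModule H M] :
    cv (LinearMap.trace k M ∘ₗ (Algebra.lsmul k k M : H →ₐ[k] Module.End k M).toLinearMap)
      ((LinearMap.trace k Q ∘ₗ LinearMap.mul k Q) ∘ₗ (π : H →ₗ[k] Q)) =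
    (Module.finrank k M : k) •
      ((LinearMap.trace k Q ∘ₗ LinearMap.mul k Q) ∘ₗ (π : H →ₗ[k] Q)) := by
  apply killed π hsurj
  intro h hh
  have h3 := hker h hh
  rw [Ideal.jacobson_bot] at h3
  have h4 := IsSemisimpleModule.jacobson_le_annihilator H M h3
  ext m
  exact Module.mem_annihilator.mp h4 m

lemma induct (π : H →ₐc[k] Q) (hsurj : Function.Surjective π)
    (hker : ∀ h : H, π h = 0 → h ∈ Ideal.jacobson (⊥ : Ideal H)) (n : ℕ) :
    ∀ (M : Type x) [AddCommGroup M] [Module k M] [Module H M] [IsScalarTower k H M]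
      [FiniteDimensional k M], Module.finrank k M = n →
    cv (LinearMap.trace k M ∘ₗ (Algebra.lsmul k k M : H →ₐ[k] Module.End k M).toLinearMap)
      ((LinearMap.trace k Q ∘ₗ LinearMap.mul k Q) ∘ₗ (π : H →ₗ[k] Q)) =
    (Module.finrank k M : k) •
      ((LinearMap.trace k Q ∘ₗ LinearMap.mul k Q) ∘ₗ (π : H →ₗ[k] Q)) := by
  induction n using Nat.strong_induction_on with
  | _ n ih =>
  intro M _ _ _ _ _ hn
  rcases subsingleton_or_nontrivial M with hM | hM
  · apply killed π hsurj
    intro h _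
    ext m
    exact Subsingleton.elim _ _
  have : Module.Finite H M := Module.Finite.of_restrictScalars_finite k H M
  obtain ⟨N, hN⟩ := IsCoatomic.exists_coatom (Submodule H M)
  have hS : IsSimpleModule H (M ⧸ N) := isSimpleModule_iff_isCoatom.mpr hN
  have hfin : Module.finrank k (M ⧸ N) + Module.finrank k N = Module.finrank k M :=
    Submodule.finrank_quotient_add_finrank (N.restrictScalars k)
  have : FiniteDimensional k N := inferInstanceAs (FiniteDimensional k (N.restrictScalars k))
  have : FiniteDimensional k (M ⧸ N) :=
    inferInstanceAs (FiniteDimensional k (M ⧸ (N.restrictScalars k)))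
  have : Nontrivial (M ⧸ N) := IsSimpleModule.nontrivial H _
  have hpos : 0 < Module.finrank k (M ⧸ N) := Module.finrank_pos
  have e1 := ih (Module.finrank k N) (by omega) N rfl
  have e2 := simple_case π hsurj hker (M ⧸ N)
  have e3 : LinearMap.trace k M ∘ₗ (Algebra.lsmul k k M : H →ₐ[k] Module.End k M).toLinearMap =
      LinearMap.trace k N ∘ₗ (Algebra.lsmul k k N : H →ₐ[k] Module.End k N).toLinearMap +
      LinearMap.trace k (M ⧸ N) ∘ₗ
        (Algebra.lsmul k k (M ⧸ N) : H →ₐ[k] Module.End k (M ⧸ N)).toLinearMap := by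
    ext h
    apply trace_add (N.subtype.restrictScalars k) (N.mkQ.restrictScalars k)
    · exact N.subtype_injective
    · exact N.mkQ_surjective
    · exact LinearMap.exact_subtype_mkQ N
    · ext; simp
    · ext; simp
  rw [e3, cv_add, e1, e2, ← add_smul, ← hfin]
  push_cast
  rw [add_comm]
end
end S17


/-- Let `H` be a finite-dimensional Hopf algebra over a field `k` of
characteristic zero with the Chevalley property, with Jacobson radical `J` and quotient
Hopf algebra map `π : H → H/J` (modelled by a surjective bialgebra homomorphism onto a
Hopf algebra `Q` whose kernel is the Jacobson radical of `H`).  Then the regular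
character of `H` satisfies `χ_H = (dim H / dim (H/J)) · (χ_{H/J} ∘ π)`. -/
theorem stmt17 {k H Q : Type*} [Field k] [CharZero k] [IsAlgClosed k]
    [Ring H] [HopfAlgebra k H] [FiniteDimensional k H]
    [Ring Q] [HopfAlgebra k Q] [FiniteDimensional k Q]
    (π : H →ₐc[k] Q) (hsurj : Function.Surjective π)
    (hker : ∀ h : H, π h = 0 ↔ h ∈ Ideal.jacobson (⊥ : Ideal H)) :
    regChar k H =
      ((Module.finrank k H : k) / (Module.finrank k Q : k)) •
        (regChar k Q ∘ₗ (π : H →ₗ[k] Q)) := by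
  have h1 := S17.induct π hsurj (fun h => (hker h).mp) _ H rfl
  have h2 := S17.leftL (k := k) (H := H) (M := Q)
    ((Algebra.lmul k Q).comp (π : H →ₐ[k] Q))
  have e1 : LinearMap.trace k H ∘ₗ (Algebra.lsmul k k H : H →ₐ[k] Module.End k H).toLinearMap =
    regChar k H := rfl
  have e2 : LinearMap.trace k Q ∘ₗ ((Algebra.lmul k Q).comp (π : H →ₐ[k] Q)).toLinearMap =
    regChar k Q ∘ₗ (π : H →ₗ[k] Q) := rfl
  have e3 : LinearMap.trace k H ∘ₗ LinearMap.mul k H = regChar k H := rfl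
  have e4 : LinearMap.trace k Q ∘ₗ LinearMap.mul k Q = regChar k Q := rfl
  rw [e1, e4] at h1
  rw [e2, e3, h1] at h2
  rw [div_eq_inv_mul, mul_smul, h2, smul_smul, inv_mul_cancel₀ S17.finrank_ne, one_smul]
end

section
/- Let H be a finite-dimensional Hopf algebra over a field k of characteristic zero with both the Chevalley property and the dual Chevalley property (i.e., H* also has the Chevalley property). Then the composite (H*/J_{H*})* ↪ H → H/J of the inclusion of the maximal semisimple sub-Hopf-algebra of H with the quotient onto the maximal semisimple quotient Hopf algebra of H is an isomorphism of Hopf algebras; in particular the quotient map π : H → H/J admits a Hopf algebra section. -/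
open TensorProduct

/-- The convolution product on the dual `H*` of a `k`-coalgebra `H`. -/
noncomputable def convMul (k H : Type*) [CommRing k] [AddCommGroup H] [Module k H]
    [Coalgebra k H] :
    Module.Dual k H →ₗ[k] Module.Dual k H →ₗ[k] Module.Dual k H :=
  TensorProduct.curry
    ((Coalgebra.comul (R := k) (A := H)).dualMap ∘ₗ TensorProduct.dualDistrib k H H)


section Part_nt

theorem nt_aux {k ι : Type*} [Field k] [CharZero k] [Fintype ι] {N : ℕ} (hN : 0 < N) {ζ : k}
    (hζ : IsPrimitiveRoot ζ N) (D : ι → Polynomial ℤ)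
    (h : ∑ i, Polynomial.aeval ζ (D i) * Polynomial.aeval ζ⁻¹ (D i) = 0) (i : ι) :
    Polynomial.aeval ζ (D i) = 0 := by
  classical
  have hc : IsPrimitiveRoot (Complex.exp (2 * Real.pi * Complex.I / N)) N :=
    Complex.isPrimitiveRoot_exp N hN.ne'
  set z := Complex.exp (2 * Real.pi * Complex.I / N) with hz
  have key : ∀ p : Polynomial ℤ, Polynomial.aeval ζ p = 0 ↔ Polynomial.aeval z p = 0 := by
    intro p
    rw [minpoly.isIntegrallyClosed_dvd_iff (hζ.isIntegral hN),
      minpoly.isIntegrallyClosed_dvd_iff (hc.isIntegral hN),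
      ← Polynomial.cyclotomic_eq_minpoly hζ hN, ← Polynomial.cyclotomic_eq_minpoly hc hN]
  have inv1 : ∀ {K : Type _} [Field K] {x : K}, IsPrimitiveRoot x N → x⁻¹ = x ^ (N - 1) := by
    intro K _ x hx
    apply inv_eq_of_mul_eq_one_right
    rw [← pow_succ', Nat.sub_add_cancel hN, hx.pow_eq_one]
  have inv2 : z⁻¹ = z ^ (N - 1) := by
    apply inv_eq_of_mul_eq_one_right
    rw [← pow_succ', Nat.sub_add_cancel hN, hc.pow_eq_one]
  let M : Polynomial ℤ := ∑ i, D i * (D i).comp (Polynomial.X ^ (N - 1))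
  have h1 : Polynomial.aeval ζ M = 0 := by
    simp only [M, map_sum, map_mul, Polynomial.aeval_comp, map_pow, Polynomial.aeval_X]
    rw [← inv1 hζ]; exact h
  rw [key] at h1 ⊢
  simp only [M, map_sum, map_mul, Polynomial.aeval_comp, map_pow, Polynomial.aeval_X] at h1
  rw [← inv2] at h1
  have hconj : z⁻¹ = (starRingEnd ℂ) z := by
    apply Complex.inv_eq_conj
    exact hc.norm'_eq_one hN.ne'
  have h2 : ∀ i, Polynomial.aeval z (D i) * Polynomial.aeval z⁻¹ (D i)
      = ((Complex.normSq (Polynomial.aeval z (D i)) : ℝ) : ℂ) := by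
    intro i
    rw [← Complex.mul_conj, hconj]
    congr 1
    exact Polynomial.aeval_algHom_apply ((starRingEnd ℂ).toIntAlgHom) z (D i)
  simp only [h2] at h1
  rw [← Complex.ofReal_sum] at h1
  have h3 := Complex.ofReal_eq_zero.mp h1
  rw [Finset.sum_eq_zero_iff_of_nonneg (fun i _ => Complex.normSq_nonneg _)] at h3
  exact Complex.normSq_eq_zero.mp (h3 i (Finset.mem_univ i))

theorem trace_aux {k V : Type*} [Field k] [CharZero k] [IsAlgClosed k] [AddCommGroup V]
    [Module k V] [FiniteDimensional k V] {N : ℕ} (hN : 0 < N) {ζ : k}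
    (hζ : IsPrimitiveRoot ζ N) (f g : Module.End k V) (hf : f ^ N = 1) (hgf : g * f = 1) :
    ∃ D : Polynomial ℤ, LinearMap.trace k V f = Polynomial.aeval ζ D ∧
      LinearMap.trace k V g = Polynomial.aeval ζ⁻¹ D := by
  classical
  have hss : f.IsSemisimple := by
    refine Module.End.isSemisimple_of_squarefree_aeval_eq_zero
      (p := (Polynomial.X ^ N - 1 : Polynomial k)) ?_ (by simp [hf])
    exact (Polynomial.separable_X_pow_sub_C (1 : k) (by exact_mod_cast hN.ne') one_ne_zero).squarefree
  have hintl : DirectSum.IsInternal f.eigenspace :=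
    DirectSum.isInternal_submodule_of_iSupIndep_of_iSup_eq_top
      f.eigenspaces_iSupIndep (by exact hss.iSup_eigenspace_eq_top)
  have hpow : ∀ μ : k, f.eigenspace μ ≠ ⊥ → ∃ j : ℕ, μ = ζ ^ j := by
    intro μ hμ
    have he : f.HasEigenvalue μ := hμ
    obtain ⟨v, hv⟩ := he.exists_hasEigenvector
    have h1 : (f ^ N) v = μ ^ N • v := hv.pow_apply N
    rw [hf] at h1
    have h2 : μ ^ N = 1 := by
      have : (μ ^ N - 1) • v = 0 := by rw [sub_smul, ← h1]; simp
      exact sub_eq_zero.mp ((smul_eq_zero.mp this).resolve_right hv.2)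
    haveI : NeZero N := ⟨hN.ne'⟩
    obtain ⟨j, _, hj⟩ := hζ.eq_pow_of_pow_eq_one h2
    exact ⟨j, hj.symm⟩
  have hfin : {μ | f.eigenspace μ ≠ ⊥}.Finite :=
    WellFoundedGT.finite_ne_bot_of_iSupIndep f.eigenspaces_iSupIndep
  have hg : ∀ μ, f.eigenspace μ ≠ ⊥ → ∀ v ∈ f.eigenspace μ, g v = μ⁻¹ • v := by
    intro μ hμ v hv
    obtain ⟨j, hj⟩ := hpow μ hμ
    have hμ0 : μ ≠ 0 := by rw [hj]; exact pow_ne_zero _ (hζ.ne_zero hN.ne')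
    have h1 : f v = μ • v := Module.End.mem_eigenspace_iff.mp hv
    have h2 : g (f v) = v := by
      have := congrArg (fun F : Module.End k V => F v) hgf
      simpa using this
    rw [h1, map_smul] at h2
    rw [← h2, smul_smul, inv_mul_cancel₀ hμ0, one_smul, h2]
  have hmf : ∀ μ, Set.MapsTo f (f.eigenspace μ) (f.eigenspace μ) := by
    intro μ v hv
    have h1 : f v = μ • v := Module.End.mem_eigenspace_iff.mp hv
    rw [h1]; exact Submodule.smul_mem _ _ hv
  have hmg : ∀ μ, Set.MapsTo g (f.eigenspace μ) (f.eigenspace μ) := by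
    intro μ v hv
    by_cases hμ : f.eigenspace μ = ⊥
    · have : v = 0 := by rw [SetLike.mem_coe, hμ] at hv; simpa using hv
      subst this; simp
    · rw [hg μ hμ v hv]; exact Submodule.smul_mem _ _ hv
  choose! j hj using hpow
  refine ⟨∑ μ ∈ hfin.toFinset, (Module.finrank k (f.eigenspace μ) : Polynomial ℤ) *
    Polynomial.X ^ (j μ), ?_, ?_⟩
  · rw [LinearMap.trace_eq_sum_trace_restrict' hintl hfin hmf, map_sum]
    refine Finset.sum_congr rfl fun μ hμ => ?_
    have hμ' : f.eigenspace μ ≠ ⊥ := by simpa using hμ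
    have : f.restrict (hmf μ) = μ • LinearMap.id := by
      ext v; exact Module.End.mem_eigenspace_iff.mp v.2
    rw [this, map_smul, LinearMap.trace_id]
    simp only [map_mul, map_natCast, map_pow, Polynomial.aeval_X, ← hj μ hμ', smul_eq_mul]
    ring
  · rw [LinearMap.trace_eq_sum_trace_restrict' hintl hfin hmg, map_sum]
    refine Finset.sum_congr rfl fun μ hμ => ?_
    have hμ' : f.eigenspace μ ≠ ⊥ := by simpa using hμ
    have : g.restrict (hmg μ) = μ⁻¹ • LinearMap.id := by
      ext v; exact hg μ hμ' v v.2
    rw [this, map_smul, LinearMap.trace_id]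
    simp only [map_mul, map_natCast, map_pow, Polynomial.aeval_X, inv_pow, ← hj μ hμ', smul_eq_mul]
    ring

/-- positivity -/
theorem pos_aux {k ι : Type*} [Field k] [CharZero k] [IsAlgClosed k] [Fintype ι]
    (n : ι → ℕ) (W W' c : ∀ i, Matrix (Fin (n i)) (Fin (n i)) k)
    (hW : ∀ i, W' i * W i = 1) (m : ℕ) (hm : 0 < m) (hc : ∀ i, c i ^ m = 1)
    (hz : ∀ i, ∃ z : k, z ≠ 0 ∧ c i * (W i * W i) = z • 1) (i₀ : ι)
    (htr : ∀ i, (W i).trace = 1) : ∑ i, (W' i).trace ≠ 0 := by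
  intro h0
  haveI : NeZero (2 * m) := ⟨by omega⟩
  obtain ⟨ζ, hζ⟩ := HasEnoughRootsOfUnity.exists_primitiveRoot k (2 * m)
  have key : ∀ i, ∃ D : Polynomial ℤ, ∃ s : k, s ≠ 0 ∧ (W i).trace = s * Polynomial.aeval ζ D ∧
      (W' i).trace = s⁻¹ * Polynomial.aeval ζ⁻¹ D := by
    intro i
    obtain ⟨z, hz0, hz⟩ := hz i
    obtain ⟨s, hs⟩ := IsAlgClosed.exists_pow_nat_eq z (n := 2) (by norm_num)
    have hs0 : s ≠ 0 := by rintro rfl; apply hz0; rw [← hs]; simp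
    have hWW' : W i * W' i = 1 := mul_eq_one_comm.mp (hW i)
    have e1 : c i = z • (W' i * W' i) := by
      have : c i * (W i * W i) * (W' i * W' i) = c i := by
        rw [mul_assoc, mul_assoc (W i), ← mul_assoc (W i) (W' i), hWW', one_mul, hWW', mul_one]
      rw [← this, hz]; simp
    have e2 : (s • W' i) ^ (2 * m) = 1 := by
      rw [pow_mul, smul_pow, hs, pow_two, ← e1, hc]
    have e3 : (s⁻¹ • W i) ^ (2 * m) = 1 := by
      have hcomm : Commute (s • W' i) (s⁻¹ • W i) := by
        simp [Commute, SemiconjBy, hs0, hWW', hW i]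
      have hp : (s • W' i) * (s⁻¹ • W i) = 1 := by simp [hs0, hW i]
      have := hcomm.mul_pow (2 * m)
      rw [hp, one_pow, e2, one_mul] at this
      exact this.symm
    obtain ⟨D, h1, h2⟩ := trace_aux (by omega) hζ (Matrix.toLin' (s⁻¹ • W i)) (Matrix.toLin' (s • W' i))
      (by rw [← Matrix.toLin'_pow, e3, Matrix.toLin'_one]; rfl)
      (by rw [Module.End.mul_eq_comp, ← Matrix.toLin'_mul]; simp [hs0, hW i]; rfl)
    rw [Matrix.trace_toLin'_eq, Matrix.trace_smul, smul_eq_mul] at h1 h2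
    refine ⟨D, s, hs0, ?_, ?_⟩
    · rw [← h1]; field_simp
    · rw [← h2]; field_simp
  choose D s hs0 h1 h2 using key
  have := nt_aux (by omega) hζ D (by
    rw [← h0]
    refine Finset.sum_congr rfl fun i _ => ?_
    have := htr i
    rw [h1] at this
    rw [h2, eq_inv_of_mul_eq_one_right this]) i₀
  have h3 := h1 i₀
  rw [this, htr] at h3
  simp at h3

end Part_nt

section Part_f1
theorem left_int_aux {k B : Type*} [Field k] [Ring B] [Algebra k B] [IsSemisimpleRing B]
    (ε : B →ₐ[k] k) : ∃ t : B, (∀ b, b * t = ε b • t) ∧ ε t = 1 := by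
  obtain ⟨e, he⟩ : ∃ e : B, ε e = 0 ∧ ∀ b, ε b = 0 → b * e = b := by
    obtain ⟨P, hP⟩ := exists_isCompl (RingHom.ker (ε : B →+* k) : Submodule B B)
    have h1 : (1 : B) ∈ (RingHom.ker (ε : B →+* k) : Submodule B B) ⊔ P := by
      rw [hP.sup_eq_top]; trivial
    obtain ⟨e, he, p, hp, hep⟩ := Submodule.mem_sup.mp h1
    refine ⟨e, he, fun b hb => ?_⟩
    have h2 : b * p = 0 := by
      have h3 : b * p ∈ P := P.smul_mem b hp
      have h4 : b * p ∈ (RingHom.ker (ε : B →+* k) : Submodule B B) := by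
        have : b * p = b - b * e := by
          rw [eq_sub_iff_add_eq, ← mul_add, add_comm p e, hep, mul_one]
        rw [this]
        exact Submodule.sub_mem _ hb ((RingHom.ker (ε : B →+* k)).mul_mem_left b he)
      exact (Submodule.disjoint_def.mp hP.disjoint) _ h4 h3
    have : b * e + b * p = b := by rw [← mul_add, hep, mul_one]
    rwa [h2, add_zero] at this
  refine ⟨1 - e, fun b => ?_, by simp [he.1]⟩
  have := he.2 (b - algebraMap k B (ε b)) (by simp)
  rw [sub_mul] at this
  rw [mul_sub, mul_one, smul_sub, Algebra.smul_def, Algebra.smul_def, mul_one]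
  rw [sub_eq_sub_iff_add_eq_add] at this ⊢
  rw [add_comm, add_comm _ (b * e), this, add_comm]

theorem int_aux {k B : Type*} [Field k] [Ring B] [Algebra k B] [IsSemisimpleRing B]
    (ε : B →ₐ[k] k) : ∃ t : B, (∀ b, b * t = ε b • t) ∧ (∀ b, t * b = ε b • t) ∧ ε t = 1 := by
  obtain ⟨t, h1, h2⟩ := left_int_aux ε
  let ε' : Bᵐᵒᵖ →ₐ[k] k :=
    AlgHom.ofLinearMap (ε.toLinearMap ∘ₗ (MulOpposite.opLinearEquiv k).symm.toLinearMap) (by simp)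
      (by intro x y; simp [mul_comm])
  obtain ⟨s, h3, h4⟩ := left_int_aux ε'
  have h3' : ∀ b, s.unop * b = ε b • s.unop := fun b => by
    have := congrArg MulOpposite.unop (h3 (MulOpposite.op b))
    exact this
  have h4' : ε s.unop = 1 := h4
  have : s.unop = t := by
    have e1 := h3' t
    rw [h1, h4', h2] at e1; simpa using e1.symm
  exact ⟨t, h1, fun b => by rw [← this]; exact h3' b, h2⟩

open Matrix in
/-- F8, matrix form -/
theorem W_aux {k ι κ : Type*} [Field k] [Fintype ι] [DecidableEq ι] (n : ι → ℕ) [∀ i, NeZero (n i)]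
    (s : Finset κ) (x y : κ → (∀ i, Matrix (Fin (n i)) (Fin (n i)) k))
    (h : ∀ b (φ ψ : (∀ i, Matrix (Fin (n i)) (Fin (n i)) k) →ₗ[k] k),
      ∑ j ∈ s, φ (b * x j) * ψ (y j) = ∑ j ∈ s, φ (x j) * ψ (y j * b))
    (h1 : ∑ j ∈ s, x j * y j = 1) (i : ι) :
    ∑ j ∈ s, (x j i).trace * ∑ i', (y j i').trace = 1 := by
  let co : ∀ (i : ι) (p q : Fin (n i)), (∀ i, Matrix (Fin (n i)) (Fin (n i)) k) →ₗ[k] k :=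
    fun i p q =>
    { toFun := fun x => x i p q, map_add' := fun _ _ => rfl, map_smul' := fun _ _ => rfl }
  let T : ∀ (i : ι), (∀ i, Matrix (Fin (n i)) (Fin (n i)) k) →ₗ[k] k :=
    fun i => Matrix.traceLinearMap _ k k ∘ₗ LinearMap.proj i
  -- kill other components
  have e1 : ∀ i', i' ≠ i → ∑ j ∈ s, (x j i).trace * (y j i').trace = 0 := by
    intro i' hi
    have := h (Pi.single i 1) (T i) (T i')
    simpa [T, hi] using this
  have e2 : ∑ j ∈ s, (x j i).trace * ∑ i', (y j i').trace
      = ∑ j ∈ s, (x j i).trace * (y j i).trace := by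
    simp_rw [Finset.mul_sum]
    rw [Finset.sum_comm, Finset.sum_eq_single i (fun i' _ hi => e1 i' hi) (by simp)]
  rw [e2]
  have e3 : ∀ (r p q u v : Fin (n i)), ∑ j ∈ s, x j i p q * y j i u v
      = if p = v then ∑ j ∈ s, x j i r q * y j i u r else 0 := by
    intro r p q u v
    have : ∑ j ∈ s, ((Pi.single i (Matrix.single r p 1) : ∀ i, Matrix (Fin (n i)) (Fin (n i)) k) i
          * x j i) r q * y j i u v = ∑ j ∈ s, x j i r q * (y j i *
          (Pi.single i (Matrix.single r p 1) : ∀ i, Matrix (Fin (n i)) (Fin (n i)) k) i) u v :=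
      h (Pi.single i (Matrix.single r p 1)) (co i r q) (co i u v)
    rw [Pi.single_eq_same] at this
    simp only [Matrix.single_mul_apply_same, one_mul] at this
    rw [this]
    split_ifs with hpv
    · subst hpv; simp
    · refine Finset.sum_eq_zero fun j _ => ?_
      rw [Matrix.mul_single_apply_of_ne _ _ _ _ _ (Ne.symm hpv), mul_zero]
  let r : Fin (n i) := 0
  have e4 : ∑ j ∈ s, (x j i).trace * (y j i).trace
      = ∑ p, ∑ u, ∑ j ∈ s, x j i p p * y j i u u := by
    simp only [Matrix.trace, Matrix.diag_apply, Finset.sum_mul_sum]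
    rw [Finset.sum_comm]
    exact Finset.sum_congr rfl fun p _ => Finset.sum_comm
  rw [e4]
  have e5 : ∑ j ∈ s, ∑ p, x j i r p * y j i p r = 1 := by
    have := congrFun (congrFun (congrFun h1 i) r) r
    simpa [Finset.sum_apply, Matrix.sum_apply, Matrix.mul_apply] using this
  rw [← e5, Finset.sum_comm (s := s)]
  refine Finset.sum_congr rfl fun p _ => ?_
  refine (Finset.sum_congr rfl fun u _ => e3 r p p u u).trans ?_
  rw [Finset.sum_ite_eq]; simp

/-- F9: a semiconjugating element with nonvanishing components is a unit. -/
theorem unit_aux {k ι : Type*} [Field k] [Finite ι] (n : ι → ℕ)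
    (w : ∀ i, Matrix (Fin (n i)) (Fin (n i)) k) (hw : ∀ i, w i ≠ 0)
    (s : (∀ i, Matrix (Fin (n i)) (Fin (n i)) k) → (∀ i, Matrix (Fin (n i)) (Fin (n i)) k))
    (h : ∀ b, w * b = s b * w) : IsUnit w := by
  classical
  rw [Pi.isUnit_iff]
  intro i
  rw [Matrix.isUnit_iff_isUnit_det, isUnit_iff_ne_zero]
  intro hdet
  obtain ⟨v, hv, hv0⟩ := Matrix.exists_mulVec_eq_zero_iff.mpr hdet
  obtain ⟨q, hq⟩ := Function.ne_iff.mp hv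
  apply hw i
  ext p r
  have := congrArg (fun M => (M i).mulVec v) (h (Pi.single i (Matrix.single r q 1)))
  simp only [Pi.mul_apply, Pi.single_eq_same] at this
  rw [← Matrix.mulVec_mulVec, ← Matrix.mulVec_mulVec, hv0, Matrix.mulVec_zero] at this
  have h3 : (Matrix.single r q (1 : k)).mulVec v = Pi.single r (v q) := by
    ext a
    simp only [Matrix.mulVec, dotProduct, Matrix.single, Matrix.of_apply, Pi.single_apply]
    by_cases har : r = a
    · subst har; simp
    · simp [har, Ne.symm har]
  rw [h3, Matrix.mulVec_single] at this
  have h2 := congrFun this p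
  have hq0 : v q ≠ 0 := hq
  simpa [hq0] using h2

end Part_f1

section Part_h1
open TensorProduct Coalgebra HopfAlgebra WithConv

section HopfAux
variable {k B : Type*} [Field k] [Ring B] [HopfAlgebra k B]

/-- `b ↦ b ⊗ 1` -/
noncomputable abbrev inlC (k B : Type*) [Field k] [Ring B] [HopfAlgebra k B] : B →ₗ[k] B ⊗[k] B :=
  (Algebra.TensorProduct.includeLeft : B →ₐ[k] B ⊗[k] B).toLinearMap
/-- `b ↦ 1 ⊗ b` -/
noncomputable abbrev inrC (k B : Type*) [Field k] [Ring B] [HopfAlgebra k B] : B →ₗ[k] B ⊗[k] B :=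
  (Algebra.TensorProduct.includeRight : B →ₐ[k] B ⊗[k] B).toLinearMap

theorem conv_inl_inr : toConv (inlC k B) * toConv (inrC k B) = toConv (comul (R := k) (A := B)) := by
  ext b
  rw [(ℛ k b).convMul_apply]
  conv_rhs => rw [WithConv.ofConv_toConv, ← (ℛ k b).eq]
  simp

theorem conv_algHom_S {A : Type*} [Ring A] [Algebra k A] (f : B →ₐ[k] A) :
    toConv (f.toLinearMap ∘ₗ antipode k (A := B)) * toConv f.toLinearMap = 1 := by
  apply WithConv.ofConv_injective
  ext b
  have h := congrArg (fun g => f (g.ofConv b)) (LinearMap.antipode_mul_id (R := k) (C := B))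
  simp only [(ℛ k b).convMul_apply] at h ⊢
  simpa using h

theorem conv_algHom_S' {A : Type*} [Ring A] [Algebra k A] (f : B →ₐ[k] A) :
    toConv f.toLinearMap * toConv (f.toLinearMap ∘ₗ antipode k (A := B)) = 1 := by
  apply WithConv.ofConv_injective
  ext b
  have h := congrArg (fun g => f (g.ofConv b)) (LinearMap.id_mul_antipode (R := k) (C := B))
  simp only [(ℛ k b).convMul_apply] at h ⊢
  simpa using h

theorem A1 {b : B} {ι : Type*} (R : Repr k b ι) :
    ∑ i ∈ R.index, (antipode k (R.left i) ⊗ₜ[k] (1 : B)) * comul (R := k) (R.right i) = 1 ⊗ₜ b := by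
  have h : toConv (inlC k B ∘ₗ antipode k (A := B)) * toConv (comul (R := k) (A := B))
      = toConv (inrC k B) := by
    rw [← conv_inl_inr, ← mul_assoc, conv_algHom_S, one_mul]
  have := congrArg (fun g => g.ofConv b) h
  simpa [R.convMul_apply] using this

theorem A2 {b : B} {ι : Type*} (R : Repr k b ι) :
    ∑ i ∈ R.index, comul (R := k) (R.left i) * ((1 : B) ⊗ₜ[k] antipode k (R.right i)) = b ⊗ₜ 1 := by
  have h : toConv (comul (R := k) (A := B)) * toConv (inrC k B ∘ₗ antipode k (A := B))
      = toConv (inlC k B) := by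
    rw [← conv_inl_inr, mul_assoc, conv_algHom_S', mul_one]
  have := congrArg (fun g => g.ofConv b) h
  simpa [R.convMul_apply] using this

theorem A3 {b : B} {ι : Type*} (R : Repr k b ι) :
    ∑ i ∈ R.index, (antipode k (A := B)).lTensor B (comul (R := k) (R.left i)) * ((1 : B) ⊗ₜ[k] (R.right i))
      = b ⊗ₜ 1 := by
  have h0 : toConv (inlC k B) * toConv (inrC k B ∘ₗ antipode k (A := B))
     = toConv ((antipode k (A := B)).lTensor B ∘ₗ comul (R := k) (A := B)) := by
    ext b
    rw [(ℛ k b).convMul_apply]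
    conv_rhs => rw [WithConv.ofConv_toConv, LinearMap.comp_apply, ← (ℛ k b).eq]
    simp
  have h : toConv ((antipode k (A := B)).lTensor B ∘ₗ comul (R := k) (A := B)) * toConv (inrC k B)
      = toConv (inlC k B) := by
    rw [← h0, mul_assoc, conv_algHom_S, mul_one]
  have := congrArg (fun g => g.ofConv b) h
  simpa [R.convMul_apply] using this

theorem A4 (b : B) : comul (R := k) (antipode k b) =
    TensorProduct.map (antipode k) (antipode k) (TensorProduct.comm k B B (comul (R := k) b)) := by
  -- x = conv S2 * S1
  have h0 : toConv (inrC k B ∘ₗ antipode k (A := B)) * toConv (inlC k B ∘ₗ antipode k (A := B))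
     = toConv (TensorProduct.map (antipode k) (antipode k) ∘ₗ (TensorProduct.comm k B B).toLinearMap ∘ₗ comul (R := k) (A := B)) := by
    ext b
    rw [(ℛ k b).convMul_apply]
    conv_rhs => rw [WithConv.ofConv_toConv, LinearMap.comp_apply, LinearMap.comp_apply, ← (ℛ k b).eq]
    simp
  have h1 : toConv (inrC k B ∘ₗ antipode k (A := B)) * toConv (inlC k B ∘ₗ antipode k (A := B)) *
      toConv (comul (R := k) (A := B)) = 1 := by
    rw [← conv_inl_inr, mul_assoc, ← mul_assoc (toConv (inlC k B ∘ₗ antipode k (A := B))), conv_algHom_S, one_mul, conv_algHom_S]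
  have h2 := left_inv_eq_right_inv h1 LinearMap.comul_right_inv
  rw [h0] at h2
  exact (congrArg (fun g => g.ofConv b) h2).symm

/-- `x ⊗ y ↦ f(y) x` -/
noncomputable def ev2 (f : B →ₗ[k] k) : B ⊗[k] B →ₗ[k] B :=
  (TensorProduct.rid k B).toLinearMap ∘ₗ f.lTensor B

@[simp] theorem ev2_tmul (f : B →ₗ[k] k) (x y : B) : ev2 f (x ⊗ₜ y) = f y • x := by simp [ev2]

theorem ev2_left (f : B →ₗ[k] k) (b : B) (X : B ⊗[k] B) :
    ev2 f ((b ⊗ₜ 1) * X) = b * ev2 f X := by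
  induction X with
  | zero => simp
  | add x y hx hy => simp [mul_add, hx, hy]
  | tmul x y => simp

theorem ev2_right (f : B →ₗ[k] k) (b : B) (X : B ⊗[k] B) :
    ev2 f (X * (b ⊗ₜ 1)) = ev2 f X * b := by
  induction X with
  | zero => simp
  | add x y hx hy => simp [add_mul, hx, hy]
  | tmul x y => simp

theorem ev2_left' (f : B →ₗ[k] k) (b : B) (X : B ⊗[k] B) :
    ev2 f ((1 ⊗ₜ b) * X) = ev2 (f ∘ₗ LinearMap.mulLeft k b) X := by
  induction X with
  | zero => simp
  | add x y hx hy => simp [mul_add, hx, hy]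
  | tmul x y => simp

theorem ev2_right' (f : B →ₗ[k] k) (b : B) (X : B ⊗[k] B) :
    ev2 f (X * (1 ⊗ₜ b)) = ev2 (f ∘ₗ LinearMap.mulRight k b) X := by
  induction X with
  | zero => simp
  | add x y hx hy => simp [add_mul, hx, hy]
  | tmul x y => simp

/-- convolution of functionals -/
noncomputable def cv (g f : B →ₗ[k] k) : B →ₗ[k] k := g ∘ₗ ev2 f ∘ₗ comul (R := k)

theorem ev2_coassoc (g f : B →ₗ[k] k) (b : B) :
    ev2 g (comul (R := k) (ev2 f (comul (R := k) b))) = ev2 (cv g f) (comul (R := k) b) := by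
  have h := Coalgebra.coassoc_apply (R := k) b
  have h1 : ∀ X : B ⊗[k] B, ev2 g (comul (R := k) (ev2 f X)) =
      ((TensorProduct.rid k B).toLinearMap ∘ₗ (g ∘ₗ ev2 f).lTensor B)
        (TensorProduct.assoc k B B B ((comul (R := k)).rTensor B X)) := by
    intro X
    induction X with
    | zero => simp
    | add x y hx hy => simp [hx, hy]
    | tmul x y =>
      simp only [ev2_tmul, map_smul, LinearMap.rTensor_tmul]
      generalize comul (R := k) x = Z
      induction Z with
      | zero => simp
      | add x y hx hy => simp only [map_add, smul_add, add_tmul, hx, hy]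
      | tmul u v => simp [smul_smul]
  rw [h1, h]
  generalize comul (R := k) b = Z
  induction Z with
  | zero => simp
  | add x y hx hy => simp only [map_add, hx, hy]
  | tmul u v => simp [cv]

/-- the same for left evaluation -/
theorem ev1_coassoc (g f : B →ₗ[k] k) (b : B) :
    ev2 g (TensorProduct.comm k B B (comul (R := k) (ev2 f (TensorProduct.comm k B B (comul (R := k) b)))))
      = ev2 (cv f g) (TensorProduct.comm k B B (comul (R := k) b)) := by
  have h := Coalgebra.coassoc_symm_apply (R := k) b
  have h1 : ∀ X : B ⊗[k] B, ev2 g (TensorProduct.comm k B B (comul (R := k) (ev2 f (TensorProduct.comm k B B X)))) =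
      ((TensorProduct.lid k B).toLinearMap ∘ₗ (f ∘ₗ ev2 g).rTensor B)
        ((TensorProduct.assoc k B B B).symm ((comul (R := k)).lTensor B X)) := by
    intro X
    induction X with
    | zero => simp
    | add x y hx hy => simp only [map_add, hx, hy]
    | tmul x y =>
      simp only [ev2_tmul, map_smul, LinearMap.lTensor_tmul, TensorProduct.comm_tmul]
      generalize comul (R := k) y = Z
      induction Z with
      | zero => simp
      | add x y hx hy => simp only [map_add, smul_add, tmul_add, hx, hy]
      | tmul u v => simp [smul_smul, mul_comm]
  rw [h1, h]
  generalize comul (R := k) b = Z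
  induction Z with
  | zero => simp
  | add x y hx hy => simp only [map_add, hx, hy]
  | tmul u v => simp [cv]

/-- mixed -/
theorem evm_coassoc (g f : B →ₗ[k] k) (b : B) :
    g (ev2 f (comul (R := k) b)) = f (ev2 g (TensorProduct.comm k B B (comul (R := k) b))) := by
  generalize comul (R := k) b = Z
  induction Z with
  | zero => simp
  | add x y hx hy => simp only [map_add, hx, hy]
  | tmul u v => simp [mul_comm]

theorem ev2_counit (b : B) : ev2 (counit (R := k)) (comul (R := k) b) = b := by
  simp [ev2]

section integral
variable {t : B}
theorem F2 (h1 : ∀ b, b * t = counit (R := k) b • t) (b : B) : ((1 : B) ⊗ₜ[k] b) * comul (R := k) t = (antipode k b ⊗ₜ[k] (1 : B)) * comul (R := k) t := by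
  rw [← A1 (ℛ k b), Finset.sum_mul]
  simp_rw [mul_assoc, ← Bialgebra.comul_mul, h1]
  have : antipode k b = ∑ i ∈ (ℛ k b).index, counit (R := k) ((ℛ k b).right i) • antipode k ((ℛ k b).left i) := by
    conv_lhs => rw [← ev2_counit (k := k) b, ← (ℛ k b).eq]
    simp
  rw [this, sum_tmul, Finset.sum_mul]
  simp [← TensorProduct.smul_tmul']

theorem F3 (h2 : ∀ b, t * b = counit (R := k) b • t) (b : B) : comul (R := k) t * (b ⊗ₜ[k] (1 : B)) = comul (R := k) t * ((1 : B) ⊗ₜ[k] antipode k b) := by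
  rw [← A2 (ℛ k b), Finset.mul_sum]
  simp_rw [← mul_assoc, ← Bialgebra.comul_mul, h2]
  have : antipode k b = ∑ i ∈ (ℛ k b).index, counit (R := k) ((ℛ k b).left i) • antipode k ((ℛ k b).right i) := by
    conv_lhs => rw [← Coalgebra.sum_counit_smul (R := k) (ℛ k b)]
    simp
  rw [this, tmul_sum, Finset.mul_sum]
  simp

theorem F4 (h1 : ∀ b, b * t = counit (R := k) b • t) (b : B) : (b ⊗ₜ[k] (1 : B)) * (antipode k (A := B)).lTensor B (comul (R := k) t) =
    (antipode k (A := B)).lTensor B (comul (R := k) t) * ((1 : B) ⊗ₜ[k] b) := by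
  let R := ℛ k t
  have key : ∀ Z : B ⊗[k] B, ∀ v : B, ∑ i ∈ R.index, TensorProduct.map (LinearMap.mulRight k (R.left i))
      (LinearMap.mulLeft k (antipode k (R.right i))) ((antipode k (A := B)).lTensor B Z * (1 ⊗ₜ v)) =
      (antipode k (A := B)).lTensor B (Z * comul (R := k) t) * (1 ⊗ₜ v) := by
    intro Z v
    induction Z with
    | zero => simp
    | add x y hx hy => simp only [map_add, add_mul, Finset.sum_add_distrib, hx, hy]
    | tmul x y =>
      rw [← R.eq]
      simp [Finset.mul_sum, Finset.sum_mul, antipode_mul_antidistrib, mul_assoc]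
  have h0 : (b ⊗ₜ[k] (1 : B)) * (antipode k (A := B)).lTensor B (comul (R := k) t) =
      ∑ i ∈ R.index, TensorProduct.map (LinearMap.mulRight k (R.left i))
      (LinearMap.mulLeft k (antipode k (R.right i))) (b ⊗ₜ 1) := by
    rw [← R.eq]; simp [Finset.mul_sum]
  rw [h0, ← A3 (ℛ k b)]
  simp_rw [map_sum]
  rw [Finset.sum_comm]
  simp_rw [key, ← Bialgebra.comul_mul, h1]
  conv_rhs => rw [← Coalgebra.sum_counit_smul (R := k) (ℛ k b)]
  rw [tmul_sum, Finset.mul_sum]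
  simp

theorem F5 (h2 : ∀ b, t * b = counit (R := k) b • t) (b : B) : (antipode k (A := B)).lTensor B (comul (R := k) t) * (b ⊗ₜ[k] (1 : B)) =
     ((1 : B) ⊗ₜ[k] antipode k (antipode k b)) * (antipode k (A := B)).lTensor B (comul (R := k) t) := by
  have := congrArg ((antipode k (A := B)).lTensor B) (F3 h2 b)
  rw [← (ℛ k t).eq] at this ⊢
  simpa [Finset.sum_mul, Finset.mul_sum, antipode_mul_antidistrib] using this
end integral

theorem ssq_mul (a b : B) : antipode k (antipode k (a * b)) = antipode k (antipode k a) * antipode k (antipode k b) := by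
  simp [antipode_mul_antidistrib]

theorem ssq_comul (b : B) : comul (R := k) (antipode k (antipode k b)) =
    TensorProduct.map (antipode k ∘ₗ antipode k) (antipode k ∘ₗ antipode k) (comul (R := k) b) := by
  rw [A4, A4]
  generalize comul (R := k) b = Z
  induction Z with
  | zero => simp
  | add x y hx hy => simp only [map_add, hx, hy]
  | tmul u v => simp

end HopfAux

end Part_h1

section Part_h2
open TensorProduct Coalgebra HopfAlgebra WithConv

section P
variable {k B : Type*} [Field k] [Ring B] [HopfAlgebra k B]

theorem P1 {n : ℕ} {d : Fin n → ℕ} [∀ i, NeZero (d i)]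
    (e : B ≃ₐ[k] (∀ i, Matrix (Fin (d i)) (Fin (d i)) k))
    (τ : B →ₗ[k] k) (hτ : ∀ b, τ b = ∑ i, (e b i).trace) {t : B}
    (h1 : ∀ b, b * t = counit (R := k) b • t) (h2 : ∀ b, t * b = counit (R := k) b • t)
    (ht : counit (R := k) t = 1) (w : B)
    (hw : w = ev2 τ ((antipode k (A := B)).lTensor B (comul (R := k) t))) :
    (∀ b, w * b = antipode k (antipode k b) * w) ∧ (∀ i, (e w i).trace = 1) ∧ IsUnit w := by
  have hτc : ∀ a b, τ (a * b) = τ (b * a) := by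
    intro a b
    simp only [hτ, map_mul, Pi.mul_apply]
    exact Finset.sum_congr rfl fun i _ => Matrix.trace_mul_comm _ _
  have hLR : ∀ b, τ ∘ₗ LinearMap.mulLeft k b = τ ∘ₗ LinearMap.mulRight k b := by
    intro b; ext a; simp [hτc]
  have hc : ∀ b, w * b = antipode k (antipode k b) * w := by
    intro b
    rw [hw, ← ev2_right, F5 h2, ev2_left', hLR, ← ev2_right', ← F4 h1, ev2_left]
  have htr : ∀ i, (e w i).trace = 1 := by
    intro i
    let R := ℛ k t
    rw [← W_aux d R.index (fun j => e (R.left j)) (fun j => e (antipode k (R.right j))) ?_ ?_ i]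
    · rw [hw, ← R.eq]
      simp only [map_sum, LinearMap.lTensor_tmul, ev2_tmul, Finset.sum_apply, Matrix.trace_sum, map_smul, Pi.smul_apply, Matrix.trace_smul, hτ, smul_eq_mul]
      exact Finset.sum_congr rfl fun j _ => mul_comm _ _
    · intro b φ ψ
      have := congrArg (LinearMap.mul' k k ∘ₗ TensorProduct.map (φ ∘ₗ e.toLinearMap) (ψ ∘ₗ e.toLinearMap))
        (F4 h1 (e.symm b))
      rw [← R.eq] at this
      simpa [Finset.mul_sum, Finset.sum_mul] using this
    · simp only [← map_mul, ← map_sum]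
      rw [HopfAlgebra.sum_mul_antipode_eq_smul R, ht, one_smul, map_one]
  refine ⟨hc, htr, ?_⟩
  have : IsUnit (e w) := by
    refine unit_aux d (e w) (fun i h0 => ?_) (fun b => e (antipode k (antipode k (e.symm b)))) ?_
    · have := htr i
      rw [h0] at this
      simp at this
    · intro b
      have := congrArg e (hc (e.symm b))
      simpa using this
  exact (MulEquiv.isUnit_map e).mp this

theorem ev2_sep [FiniteDimensional k B] {X Y : B ⊗[k] B} (h : ∀ g : B →ₗ[k] k, ev2 g X = ev2 g Y) : X = Y := by
  let bs := Module.finBasis k B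
  have key : ∀ Z : B ⊗[k] B, Z = ∑ i, (ev2 (bs.coord i) Z) ⊗ₜ bs i := by
    intro Z
    induction Z with
    | zero => simp
    | add x y hx hy => simp only [map_add, add_tmul, Finset.sum_add_distrib, ← hx, ← hy]
    | tmul u v =>
      simp only [ev2_tmul, smul_tmul, ← tmul_sum, Module.Basis.coord_apply]
      rw [bs.sum_repr]
  rw [key X, key Y]
  simp only [h]

theorem P2 [FiniteDimensional k B] {τ : B →ₗ[k] k} (hτc : ∀ a b, τ (a * b) = τ (b * a)) {t : B}
    (h1 : ∀ b, b * t = counit (R := k) b • t) (h2 : ∀ b, t * b = counit (R := k) b • t)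
    (w w' : B) (hww' : w * w' = 1) (hw'w : w' * w = 1)
    (hw : w = ev2 τ ((antipode k (A := B)).lTensor B (comul (R := k) t)))
    (hc : ∀ b, w * b = antipode k (antipode k b) * w) (f : B →ₗ[k] k)
    (hf : ∀ b, f b = τ (w' * antipode k b)) :
    (∀ b, ev2 f (comul (R := k) b) = f b • 1) ∧
    ∃ c : B, IsGroupLikeElem k c ∧ ∀ b, b * (c * (w * w)) = c * (w * w) * b := by
  have hLR : ∀ b, τ ∘ₗ LinearMap.mulLeft k b = τ ∘ₗ LinearMap.mulRight k b := by
    intro b; ext a; simp [hτc]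
  -- the square of the antipode
  set σ : B →ₗ[k] B := antipode k ∘ₗ antipode k with hσ
  have hσw : ∀ b, σ b = w * b * w' := by
    intro b
    rw [hc, mul_assoc, hww', mul_one]; rfl
  have hσinj : Function.Injective σ := by
    intro a b hab
    rw [hσw, hσw] at hab
    have := congrArg (fun x => w' * x * w) hab
    simpa [mul_assoc, hw'w, ← mul_assoc w' w] using this
  have hσsurj : Function.Surjective σ := LinearMap.injective_iff_surjective.mp hσinj
  have hSinj : Function.Injective (antipode k (A := B)) := fun a b hab =>
    hσinj (by simp [hσ, hab])
  have hSsurj : Function.Surjective (antipode k (A := B)) := LinearMap.injective_iff_surjective.mp hSinj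
  -- F10
  have F10 : ev2 f (comul (R := k) t) = 1 := by
    have e1 : ∀ X : B ⊗[k] B, ev2 f X = ev2 (τ ∘ₗ LinearMap.mulLeft k w') ((antipode k (A := B)).lTensor B X) := by
      intro X
      induction X with
      | zero => simp
      | add x y hx hy => simp only [map_add, hx, hy]
      | tmul u v => simp [hf]
    rw [e1, hLR, ← ev2_right', ← F4 h1, ev2_left, ← hw, hw'w]
  have F11 : ∀ b, ev2 (f ∘ₗ LinearMap.mulLeft k b) (comul (R := k) t) = antipode k b := by
    intro b
    rw [← ev2_left', F2 h1, ev2_left, F10, mul_one]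
  have honto : ∀ h : B →ₗ[k] k, ∃ b, h = f ∘ₗ LinearMap.mulLeft k b := by
    let Θ : B →ₗ[k] (B →ₗ[k] k) := LinearMap.llcomp k B B k f ∘ₗ LinearMap.mul k B
    have hΘ : ∀ b, Θ b = f ∘ₗ LinearMap.mulLeft k b := fun b => rfl
    have hinj : Function.Injective Θ := by
      intro a b hab
      apply hSinj
      rw [← F11, ← F11, ← hΘ, ← hΘ, hab]
    have hs : Function.Surjective Θ := by
      refine (LinearMap.injective_iff_surjective_of_finrank_eq_finrank ?_).mp hinj
      exact (Subspace.dual_finrank_eq (K := k) (V := B)).symm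
    intro h
    obtain ⟨b, hb⟩ := hs h
    exact ⟨b, hb.symm⟩
  have Finj : ∀ h h' : B →ₗ[k] k, ev2 h (comul (R := k) t) = ev2 h' (comul (R := k) t) → h = h' := by
    intro h h' hh
    obtain ⟨b, rfl⟩ := honto h
    obtain ⟨b', rfl⟩ := honto h'
    rw [F11, F11] at hh
    rw [hSinj hh]
  have F12 : ∀ b, ev2 f (comul (R := k) b) = f b • 1 := by
    intro b
    have e1 : ∀ g : B →ₗ[k] k, cv g f = g 1 • f := by
      intro g
      apply Finj
      rw [← ev2_coassoc, F10, Bialgebra.comul_one, Algebra.TensorProduct.one_def, ev2_tmul]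
      have : ev2 (g 1 • f) (comul (R := k) t) = g 1 • ev2 f (comul (R := k) t) := by
        simp [ev2]
      rw [this, F10]
    rw [← sub_eq_zero]
    refine (Module.forall_dual_apply_eq_zero_iff k _).mp fun g => ?_
    have e2 : g (ev2 f (comul (R := k) b)) = g 1 * f b := congrArg (fun h => h b) (e1 g)
    rw [map_sub, e2, map_smul, smul_eq_mul, mul_comm, sub_self]
  refine ⟨F12, ?_⟩
  -- sigma-invariance
  have hσt : σ t = t := by
    rw [hσw, h1, smul_mul_assoc, h2, smul_smul, ← Bialgebra.counit_mul, hww', Bialgebra.counit_one, one_smul]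
  have hσΔ : ∀ b, comul (R := k) (σ b) = TensorProduct.map σ σ (comul (R := k) b) := fun b => ssq_comul b
  have hfσ : f ∘ₗ σ = f := by
    apply Finj
    rw [F10]
    apply hσinj
    have e1 : ∀ X : B ⊗[k] B, σ (ev2 (f ∘ₗ σ) X) = ev2 f (TensorProduct.map σ σ X) := by
      intro X
      induction X with
      | zero => simp
      | add x y hx hy => simp only [map_add, hx, hy]
      | tmul u v => simp
    rw [e1, ← hσΔ, hσt, F10]
    simp [hσ]
  have hfσ' : ∀ b, f (σ b) = f b := fun b => congrArg (fun g => g b) hfσ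
  have hσmul : ∀ a b, σ (a * b) = σ a * σ b := fun a b => ssq_mul a b
  let G : (B →ₗ[k] k) → B := fun h => ev2 h (TensorProduct.comm k B B (comul (R := k) t))
  let c := G f
  have GF : ∀ h, G h = ev2 (h ∘ₗ σ) (comul (R := k) t) * c := by
    intro h
    obtain ⟨b, hb⟩ := honto (h ∘ₗ σ)
    have hh : h = f ∘ₗ LinearMap.mulLeft k (σ b) := by
      ext x
      obtain ⟨y, rfl⟩ := hσsurj x
      have := congrArg (fun g => g y) hb
      simp only [LinearMap.comp_apply, LinearMap.mulLeft_apply] at this ⊢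
      rw [this, ← hσmul, hfσ']
    rw [hb, F11]
    have e2 : ∀ X : B ⊗[k] B, ev2 (f ∘ₗ LinearMap.mulLeft k (σ b)) (TensorProduct.comm k B B X) =
        ev2 f (TensorProduct.comm k B B ((σ b ⊗ₜ 1) * X)) := by
      intro X
      induction X with
      | zero => simp
      | add x y hx hy => simp only [map_add, mul_add, hx, hy]
      | tmul u v => simp
    have e3 : ∀ X : B ⊗[k] B,
        ev2 f (TensorProduct.comm k B B ((1 ⊗ₜ antipode k b) * X)) = antipode k b * ev2 f (TensorProduct.comm k B B X) := by
      intro X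
      induction X with
      | zero => simp
      | add x y hx hy => simp only [map_add, mul_add, hx, hy]
      | tmul u v => simp
    simp only [G, c]
    rw [hh, e2, ← e3, F2 h1]; rfl
  -- F3 consequences
  have e5 : ∀ h b, G (h ∘ₗ LinearMap.mulRight k b) = G h * antipode k b := by
    intro h b
    have e1 : ∀ X : B ⊗[k] B, ev2 (h ∘ₗ LinearMap.mulRight k b) (TensorProduct.comm k B B X) =
        ev2 h (TensorProduct.comm k B B (X * (b ⊗ₜ 1))) := by
      intro X
      induction X with
      | zero => simp
      | add x y hx hy => simp only [map_add, add_mul, hx, hy]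
      | tmul u v => simp
    have e3 : ∀ X : B ⊗[k] B,
        ev2 h (TensorProduct.comm k B B (X * (1 ⊗ₜ antipode k b))) = ev2 h (TensorProduct.comm k B B X) * antipode k b := by
      intro X
      induction X with
      | zero => simp
      | add x y hx hy => simp only [map_add, add_mul, hx, hy]
      | tmul u v => simp
    simp only [G]
    rw [e1, F3 h2, e3]
  have e6 : ∀ h b, ev2 (h ∘ₗ LinearMap.mulRight k (antipode k b)) (comul (R := k) t) = ev2 h (comul (R := k) t) * b := by
    intro h b
    rw [← ev2_right', ← F3 h2, ev2_right]
  have F15 : ∀ b, c * σ (σ b) = b * c := by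
    intro b
    have h3 := e5 f (antipode k (σ b))
    rw [GF] at h3
    have h4 : (f ∘ₗ LinearMap.mulRight k (antipode k (σ b))) ∘ₗ σ = f ∘ₗ LinearMap.mulRight k (antipode k b) := by
      ext x
      simp only [LinearMap.comp_apply, LinearMap.mulRight_apply]
      have : antipode k (σ b) = σ (antipode k b) := rfl
      rw [this, ← hσmul, hfσ']
    rw [h4, e6, F10, one_mul] at h3
    exact h3.symm
  have hεc : counit (R := k) c = 1 := by
    have e1 := evm_coassoc f (counit (R := k)) t
    rw [ev2_counit] at e1
    have e2 := congrArg (counit (R := k)) (F12 t)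
    rw [F10, map_smul, Bialgebra.counit_one, smul_eq_mul, mul_one] at e2
    exact e1.symm.trans e2.symm
  have hΔ : comul (R := k) c = σ c ⊗ₜ c := by
    apply (TensorProduct.comm k B B).injective
    apply ev2_sep
    intro g
    have e1 := ev1_coassoc g f t
    have e2 : (cv f g) ∘ₗ σ = cv f (g ∘ₗ σ) := by
      ext x
      have : ∀ X : B ⊗[k] B, σ (ev2 (g ∘ₗ σ) X) = ev2 g (TensorProduct.map σ σ X) := by
        intro X
        induction X with
        | zero => simp
        | add x y hx hy => simp only [map_add, hx, hy]
        | tmul u v => simp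
      simp only [cv, LinearMap.comp_apply]
      rw [hσΔ, ← this, hfσ']
    refine e1.trans ((GF (cv f g)).trans ?_)
    rw [e2, ← ev2_coassoc, F12, evm_coassoc]
    simp [c, G]
  refine ⟨c, ⟨hεc, ?_⟩, ?_⟩
  · have e1 : c = σ c := by
      have := ev2_counit (k := k) c
      rw [hΔ, ev2_tmul, hεc, one_smul] at this
      exact this.symm
    rw [hΔ, ← e1]
  · intro b
    have h5 : σ (σ b) * (w * w) = w * w * b := by
      have : ∀ x, σ x * w = w * x := fun x => (hc x).symm
      rw [← mul_assoc, this, mul_assoc, this, mul_assoc]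
    rw [← mul_assoc, ← F15, mul_assoc, h5, ← mul_assoc]
end P

end Part_h2

section Part_h3
open TensorProduct Coalgebra HopfAlgebra WithConv

theorem LR_main {k B : Type*} [Field k] [CharZero k] [IsAlgClosed k] [Ring B] [HopfAlgebra k B]
    [FiniteDimensional k B] [IsSemisimpleRing B] :
    ∃ f : B →ₗ[k] k, f 1 ≠ 0 ∧ ∀ b, ev2 f (comul (R := k) b) = f b • 1 := by
  obtain ⟨n, d, hd, ⟨e⟩⟩ := IsSemisimpleRing.exists_algEquiv_pi_matrix_of_isAlgClosed k B
  obtain ⟨t, h1, h2, ht⟩ := int_aux (Bialgebra.counitAlgHom k B)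
  simp only [Bialgebra.counitAlgHom_apply] at h1 h2 ht
  let τ : B →ₗ[k] k := ∑ i, Matrix.traceLinearMap _ k k ∘ₗ LinearMap.proj i ∘ₗ e.toLinearMap
  have hτ : ∀ b, τ b = ∑ i, (e b i).trace := by intro b; simp [τ]
  have hτc : ∀ a b, τ (a * b) = τ (b * a) := by
    intro a b
    simp only [hτ, map_mul, Pi.mul_apply]
    exact Finset.sum_congr rfl fun i _ => Matrix.trace_mul_comm _ _
  obtain ⟨hc, htr, hu⟩ := P1 e τ hτ h1 h2 ht _ rfl
  set w := ev2 τ ((antipode k (A := B)).lTensor B (comul (R := k) t)) with hw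
  obtain ⟨w', hww', hw'w⟩ := isUnit_iff_exists.mp hu
  let f : B →ₗ[k] k := τ ∘ₗ LinearMap.mulLeft k w' ∘ₗ antipode k
  obtain ⟨hf, c, hcg, hcen⟩ := P2 hτc h1 h2 w w' hww' hw'w hw hc f (fun b => rfl)
  refine ⟨f, ?_, hf⟩
  have hcpow : ∃ m, 0 < m ∧ c ^ m = 1 := by
    have : Finite (GroupLike k B) :=
      (linearIndep_groupLikeVal (R := k) (A := B)).finite
    let g : GroupLike k B := ⟨c, hcg⟩
    obtain ⟨m, hm, hgm⟩ := (isOfFinOrder_of_finite g).exists_pow_eq_one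
    refine ⟨m, hm, ?_⟩
    have := congrArg GroupLike.val hgm
    simpa using this
  obtain ⟨m, hm, hcm⟩ := hcpow
  have hnt : Nonempty (Fin n) := by
    by_contra hemp
    rw [not_nonempty_iff] at hemp
    have h0 : (1 : B) = 0 := e.injective (Subsingleton.elim _ _)
    have := congrArg (counit (R := k)) h0
    simp at this
  have := pos_aux d (fun i => e w i) (fun i => e w' i) (fun i => e c i)
    (fun i => by have := congrFun (congrArg e hw'w) i; simpa using this) m hm
    (fun i => by have := congrFun (congrArg e hcm) i; simpa using this) ?_ hnt.some htr
  · have hf1 : f 1 = τ w' := by simp [f, antipode_one]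
    rw [hf1, hτ]; exact this
  · intro i
    have hZ : e c i * (e w i * e w i) ∈ Set.range (Matrix.scalar (Fin (d i)) : k → _) := by
      rw [Matrix.mem_range_scalar_iff_commute_single']
      intro p q
      have := congrFun (congrArg e (hcen (e.symm (Pi.single i (Matrix.single p q 1))))) i
      simpa [Commute, SemiconjBy] using this
    obtain ⟨z, hz⟩ := hZ
    refine ⟨z, ?_, ?_⟩
    · rintro rfl
      have hU : IsUnit (c * (w * w)) := (IsUnit.of_pow_eq_one hcm hm.ne').mul (hu.mul hu)
      have hU2 := (Pi.isUnit_iff.mp (hU.map e)) i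
      simp only [map_mul, Pi.mul_apply] at hU2
      rw [← hz, map_zero] at hU2
      have : (0 : Matrix (Fin (d i)) (Fin (d i)) k) = 1 := by simpa using hU2
      have h3 := congrFun (congrFun this 0) 0
      simp at h3
    · rw [← hz]
      ext p q
      simp [Matrix.scalar_apply, Matrix.diagonal_apply, Matrix.one_apply]

end Part_h3

section Part_h4
open TensorProduct Coalgebra HopfAlgebra WithConv

section M
variable {k B : Type*} [Field k] [Ring B] [HopfAlgebra k B]

theorem A5 {b : B} {ι : Type*} (R : Repr k b ι) :
    ∑ i ∈ R.index, comul (R := k) (antipode k (R.left i)) * (R.right i ⊗ₜ[k] (1 : B))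
      = 1 ⊗ₜ antipode k b := by
  have h0 : toConv (inrC k B ∘ₗ antipode k (A := B)) * toConv (inlC k B ∘ₗ antipode k (A := B))
     = toConv (comul (R := k) (A := B) ∘ₗ antipode k) := by
    ext b
    rw [(ℛ k b).convMul_apply]
    conv_rhs => rw [WithConv.ofConv_toConv, LinearMap.comp_apply, A4, ← (ℛ k b).eq]
    simp
  have h : toConv (comul (R := k) (A := B) ∘ₗ antipode k) * toConv (inlC k B)
      = toConv (inrC k B ∘ₗ antipode k (A := B)) := by
    rw [← h0, mul_assoc, conv_algHom_S, mul_one]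
  have := congrArg (fun g => g.ofConv b) h
  simpa [R.convMul_apply] using this

theorem C1 (a : B →ₗ[k] k) (b : B) :
    (ev2 a ∘ₗ comul (R := k)).lTensor B (comul (R := k) b) = comul (R := k) (ev2 a (comul (R := k) b)) := by
  have h := Coalgebra.coassoc_apply (R := k) b
  have h1 : ∀ X : B ⊗[k] B, comul (R := k) (ev2 a X) =
      (ev2 a).lTensor B (TensorProduct.assoc k B B B ((comul (R := k)).rTensor B X)) := by
    intro X
    induction X with
    | zero => simp
    | add x y hx hy => simp only [map_add, hx, hy]
    | tmul x y =>
      simp only [ev2_tmul, map_smul, LinearMap.rTensor_tmul]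
      generalize comul (R := k) x = Z
      induction Z with
      | zero => simp
      | add x y hx hy => simp only [map_add, smul_add, add_tmul, hx, hy]
      | tmul u v => simp
  rw [h1, h, LinearMap.lTensor_comp, LinearMap.comp_apply]

theorem K1 {f : B →ₗ[k] k} (hf : ∀ b, ev2 f (comul (R := k) b) = f b • 1) (a : B →ₗ[k] k) (b c : B) :
    a (ev2 (f ∘ₗ LinearMap.mulRight k (antipode k c)) (comul (R := k) b)) =
      f (b * antipode k (ev2 a (comul (R := k) c))) := by
  have h : ev2 (f ∘ₗ LinearMap.mulRight k (antipode k c)) (comul (R := k) b) =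
      ∑ i ∈ (ℛ k c).index, f (b * antipode k ((ℛ k c).left i)) • (ℛ k c).right i := by
    rw [← ev2_right', ← A5 (ℛ k c), Finset.mul_sum, map_sum]
    refine Finset.sum_congr rfl fun i _ => ?_
    rw [← mul_assoc, ← Bialgebra.comul_mul, ev2_right, hf, smul_mul_assoc, one_mul]
  rw [h]
  conv_rhs => rw [← (ℛ k c).eq]
  simp [Finset.mul_sum, mul_comm]

theorem maschke [FiniteDimensional k B] {f : B →ₗ[k] k} (hf1 : f 1 ≠ 0)
    (hf : ∀ b, ev2 f (comul (R := k) b) = f b • 1) (I : Submodule k (Module.Dual k B))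
    (hI : ∀ g a, a ∈ I → cv g a ∈ I) : ∃ e ∈ I, ∀ a ∈ I, cv a e = a := by
  let N := I.dualCoannihilator
  obtain ⟨N', hN'⟩ := N.exists_isCompl
  -- projection with kernel N
  obtain ⟨q, hq0, hq⟩ : ∃ q : B →ₗ[k] B, (∀ x ∈ N, q x = 0) ∧ ∀ x, x - q x ∈ N := by
    refine ⟨LinearMap.id - N.subtype ∘ₗ N.projectionOnto N' hN', fun x hx => ?_, fun x => ?_⟩
    · simp [Submodule.projectionOnto_apply_left hN' ⟨x, hx⟩]
    · simp
  have hN : ∀ a ∈ I, ∀ x ∈ N, ev2 a (comul (R := k) x) = 0 := by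
    intro a ha x hx
    refine (Module.forall_dual_apply_eq_zero_iff k _).mp fun g => ?_
    exact (Submodule.mem_dualCoannihilator x).mp hx _ (hI g a ha)
  have hN2 : ∀ a ∈ I, ∀ x, ev2 a (comul (R := k) (q x)) = ev2 a (comul (R := k) x) := by
    intro a ha x
    have := hN a ha _ (hq x)
    rw [map_sub, map_sub, sub_eq_zero] at this
    exact this.symm
  -- the functional
  let Bh : B ⊗[k] B →ₗ[k] k := f ∘ₗ LinearMap.mul' k B ∘ₗ (antipode k ∘ₗ q).lTensor B
  let e' : B →ₗ[k] k := Bh ∘ₗ comul (R := k)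
  have hdd : ∀ g : Module.Dual k B, (∀ x ∈ N, g x = 0) → g ∈ I := by
    intro g hg
    rw [← Subspace.dualCoannihilator_dualAnnihilator_eq (W := I)]
    rw [Submodule.mem_dualAnnihilator]
    exact hg
  have he' : e' ∈ I := by
    refine hdd _ fun x hx => ?_
    have hz : q.lTensor B (comul (R := k) x) = 0 := by
      refine ev2_sep fun g => ?_
      have h1 : ev2 g (q.lTensor B (comul (R := k) x)) = ev2 (g ∘ₗ q) (comul (R := k) x) := by
        simp only [ev2, LinearMap.lTensor_comp, LinearMap.comp_apply]
      rw [h1, map_zero]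
      refine hN _ (hdd _ fun y hy => ?_) x hx
      simp [hq0 y hy]
    simp only [e', Bh, LinearMap.comp_apply, LinearMap.lTensor_comp, hz, map_zero]
  have key : ∀ a ∈ I, cv a e' = f 1 • a := by
    intro a ha
    ext b
    have h0 : ∀ (Z : B ⊗[k] B) (y : B), TensorProduct.rid k B (Bh.lTensor B
        (TensorProduct.assoc k B B B (Z ⊗ₜ y))) =
        ev2 (f ∘ₗ LinearMap.mulRight k (antipode k (q y))) Z := by
      intro Z y
      induction Z with
      | zero => simp
      | add u v hu hv => simp only [map_add, add_tmul, hu, hv]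
      | tmul u v => simp [Bh]
    have h1 : ∀ X : B ⊗[k] B, a (TensorProduct.rid k B (Bh.lTensor B
        (TensorProduct.assoc k B B B ((comul (R := k)).rTensor B X)))) =
        f (LinearMap.mul' k B ((antipode k).lTensor B
          ((ev2 a ∘ₗ comul (R := k)).lTensor B X))) := by
      intro X
      induction X with
      | zero => simp
      | add u v hu hv => simp only [map_add, hu, hv]
      | tmul u v =>
        rw [LinearMap.rTensor_tmul, h0, K1 hf, hN2 a ha]
        simp
    have h2 : cv a e' b = a (TensorProduct.rid k B (Bh.lTensor B
        ((comul (R := k)).lTensor B (comul (R := k) b)))) := by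
      simp only [cv, ev2, e', LinearMap.lTensor_comp, LinearMap.comp_apply, LinearEquiv.coe_coe]
    rw [h2, ← Coalgebra.coassoc_apply, h1, C1, mul_antipode_lTensor_comul_apply,
      evm_coassoc, Algebra.algebraMap_eq_smul_one, map_smul]
    have h3 : ev2 (counit (R := k)) (TensorProduct.comm k B B (comul (R := k) b)) = b := by
      conv_lhs => rw [← (ℛ k b).eq]
      simp [Coalgebra.sum_counit_smul]
    rw [h3]
    simp [mul_comm]
  refine ⟨(f 1)⁻¹ • e', I.smul_mem _ he', fun a ha => ?_⟩
  have : cv a ((f 1)⁻¹ • e') = (f 1)⁻¹ • cv a e' := by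
    ext b
    simp [cv, ev2]
  rw [this, key a ha, smul_smul, inv_mul_cancel₀ hf1, one_smul]
end M

end Part_h4

section Part_h5
open TensorProduct Coalgebra HopfAlgebra WithConv

section G
theorem jac_idem {R : Type*} [Ring R] {x : R} (hx : x ∈ Ideal.jacobson (⊥ : Ideal R))
    (h : x * x = x) : x = 0 := by
  obtain ⟨z, hz⟩ := Ideal.mem_jacobson_iff.mp hx (-1)
  rw [Ideal.mem_bot] at hz
  have h1 : z * (1 - x) = 1 := by
    rw [← sub_eq_zero, ← hz]; noncomm_ring
  calc x = z * (1 - x) * x := by rw [h1, one_mul]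
    _ = z * (x - x * x) := by noncomm_ring
    _ = 0 := by rw [h, sub_self, mul_zero]

theorem quot_semisimple (k : Type*) {R : Type*} [Field k] [Ring R] [Algebra k R]
    [FiniteDimensional k R] {Q : Type*} [Ring Q] (p : R →+* Q) (hp : Function.Surjective p)
    (hk : ∀ h : R, p h = 0 ↔ h ∈ Ideal.jacobson (⊥ : Ideal R)) : IsSemisimpleRing Q := by
  have : IsArtinianRing R := isArtinian_of_tower k inferInstance
  have h1 : IsSemisimpleRing (R ⧸ Ring.jacobson R) := IsSemiprimaryRing.isSemisimpleRing
  have h2 : RingHom.ker p = Ring.jacobson R := by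
    ext x
    rw [RingHom.mem_ker, hk, Ideal.jacobson_bot]
  have e := (Ideal.quotEquivOfEq h2).symm.trans (RingHom.quotientKerEquivOfSurjective hp)
  exact e.isSemisimpleRing

variable {k : Type*} [Field k] [CharZero k] [IsAlgClosed k]

theorem T_main {B R : Type*} [Ring B] [HopfAlgebra k B] [FiniteDimensional k B]
    [IsSemisimpleRing B] [Ring R] [Algebra k R] (T : Module.Dual k B →ₗ[k] R)
    (hT : ∀ g a, T (cv g a) = T g * T a) (hinj : Function.Injective T) (a : Module.Dual k B)
    (ha : T a ∈ Ideal.jacobson (⊥ : Ideal R)) : a = 0 := by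
  obtain ⟨f, hf1, hf⟩ := LR_main (k := k) (B := B)
  obtain ⟨e, he, hI⟩ := maschke hf1 hf
    (((Ideal.jacobson (⊥ : Ideal R)).restrictScalars k).comap T) (fun g a ha => by
      simp only [Submodule.mem_comap, Submodule.restrictScalars_mem] at ha ⊢
      rw [hT]
      exact Ideal.mul_mem_left _ _ ha)
  have he0 : T e = 0 := jac_idem he (by rw [← hT, hI e he])
  apply hinj
  rw [← hI a ha, hT, he0, mul_zero, map_zero]

theorem ev2_map {B C : Type*} [Ring B] [HopfAlgebra k B] [Ring C] [HopfAlgebra k C]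
    (p : B →ₐc[k] C) (g a : Module.Dual k C) (b : B) :
    cv g a (p b) = LinearMap.mul' k k (TensorProduct.map (g ∘ₗ (p : B →ₗ[k] C)) (a ∘ₗ (p : B →ₗ[k] C))
      (comul (R := k) b)) := by
  have : comul (R := k) (p b) = TensorProduct.map (p : B →ₗ[k] C) (p : B →ₗ[k] C) (comul (R := k) b) :=
    (CoalgHomClass.map_comp_comul_apply p b).symm
  simp only [cv, LinearMap.comp_apply, this]
  generalize comul (R := k) b = Z
  induction Z with
  | zero => simp
  | add x y hx hy => simp only [map_add, hx, hy]
  | tmul u v => simp [mul_comm]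

theorem convMul_eq {B : Type*} [Ring B] [HopfAlgebra k B] (g a : Module.Dual k B) (b : B) :
    convMul k B g a b = LinearMap.mul' k k (TensorProduct.map g a (comul (R := k) b)) := by
  simp only [convMul, TensorProduct.curry_apply, LinearMap.comp_apply, LinearMap.dualMap_apply]
  generalize comul (R := k) b = Z
  induction Z with
  | zero => simp
  | add x y hx hy => simp only [map_add, hx, hy]
  | tmul u v => simp

variable {H Q D : Type*}
    [Ring H] [HopfAlgebra k H] [FiniteDimensional k H]
    [Ring Q] [HopfAlgebra k Q] [FiniteDimensional k Q]
    [Ring D] [HopfAlgebra k D] [FiniteDimensional k D]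

theorem surj_aux (π : H →ₐc[k] Q) (hsurj : Function.Surjective π)
    (hker : ∀ h : H, π h = 0 ↔ h ∈ Ideal.jacobson (⊥ : Ideal H))
    (ψ : D ≃ₗ[k] Module.Dual k H)
    (hψmul : ∀ d d' : D, ψ (d * d') = convMul k H (ψ d) (ψ d')) (q : Q) :
    ∃ h : H, (∀ d ∈ Ideal.jacobson (⊥ : Ideal D), ψ d h = 0) ∧ π h = q := by
  have : IsSemisimpleRing Q := quot_semisimple k (π : H →+* Q) hsurj hker
  let T : Module.Dual k Q →ₗ[k] D := ψ.symm.toLinearMap ∘ₗ (π : H →ₗ[k] Q).dualMap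
  have hTψ : ∀ a, ψ (T a) = a ∘ₗ (π : H →ₗ[k] Q) := fun a => by
    simp [T, LinearMap.dualMap_apply']
  have hT : ∀ g a, T (cv g a) = T g * T a := by
    intro g a
    apply ψ.injective
    rw [hψmul]
    ext h
    rw [convMul_eq, hTψ, hTψ, hTψ, ← ev2_map]
    rfl
  have hinj : Function.Injective T := by
    intro a b hab
    have := congrArg ψ hab
    rw [hTψ, hTψ] at this
    ext q
    obtain ⟨h, rfl⟩ := hsurj q
    exact congrArg (fun f => f h) this
  let JD : Submodule k (Module.Dual k H) :=
    ((Ideal.jacobson (⊥ : Ideal D)).restrictScalars k).map ψ.toLinearMap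
  have key : JD.dualCoannihilator.map (π : H →ₗ[k] Q) = ⊤ := by
    rw [← Subspace.dualAnnihilator_inj, Submodule.dualAnnihilator_top, eq_bot_iff]
    intro a ha
    rw [Submodule.mem_dualAnnihilator] at ha
    have h2 : a ∘ₗ (π : H →ₗ[k] Q) ∈ JD := by
      rw [← Subspace.dualCoannihilator_dualAnnihilator_eq (W := JD), Submodule.mem_dualAnnihilator]
      intro x hx
      exact ha _ ⟨x, hx, rfl⟩
    obtain ⟨d, hd, hd2⟩ := h2
    refine T_main T hT hinj a ?_
    have : T a = d := ψ.injective (by rw [hTψ]; exact hd2.symm)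
    rw [this]
    exact hd
  have hq : q ∈ JD.dualCoannihilator.map (π : H →ₗ[k] Q) := by rw [key]; trivial
  obtain ⟨h, hh, rfl⟩ := hq
  exact ⟨h, fun d hd => (Submodule.mem_dualCoannihilator h).mp hh _ ⟨d, hd, rfl⟩, rfl⟩

theorem inj_aux {E : Type*} [Ring E] [HopfAlgebra k E] [FiniteDimensional k E]
    (p : D →ₐc[k] E) (hsurj : Function.Surjective p)
    (hker : ∀ d : D, p d = 0 ↔ d ∈ Ideal.jacobson (⊥ : Ideal D))
    (ψ : D ≃ₗ[k] Module.Dual k H)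
    (hψcomul : ∀ (d : D) (a b : H),
      TensorProduct.dualDistrib k H H
        (TensorProduct.map ψ.toLinearMap ψ.toLinearMap (Coalgebra.comul (R := k) d))
        (a ⊗ₜ[k] b) = ψ d (a * b)) (h : H) (hh : ∀ d ∈ Ideal.jacobson (⊥ : Ideal D), ψ d h = 0)
    (hJ : h ∈ Ideal.jacobson (⊥ : Ideal H)) : h = 0 := by
  have : IsSemisimpleRing E := quot_semisimple k (p : D →+* E) hsurj hker
  have hsep : ∀ x y : H, (∀ d, ψ d x = ψ d y) → x = y := by
    intro x y hxy
    rw [← sub_eq_zero]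
    refine (Module.forall_dual_apply_eq_zero_iff k _).mp fun g => ?_
    have := hxy (ψ.symm g)
    simpa [sub_eq_zero] using this
  let T : Module.Dual k E →ₗ[k] H := (Module.evalEquiv k H).symm.toLinearMap ∘ₗ
    (ψ.symm.toLinearMap).dualMap ∘ₗ (p : D →ₗ[k] E).dualMap
  have hTψ : ∀ a d, ψ d (T a) = a (p d) := fun a d => by
    have : Module.evalEquiv k H (T a) = (ψ.symm.toLinearMap).dualMap ((p : D →ₗ[k] E).dualMap a) := by
      simp [T]
    have := congrArg (fun f => f (ψ d)) this
    simpa using this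
  have hT : ∀ g a, T (cv g a) = T g * T a := by
    intro g a
    apply hsep
    intro d
    rw [← hψcomul, hTψ, ev2_map]
    generalize comul (R := k) d = Z
    induction Z with
    | zero => simp
    | add x y hx hy => simp only [map_add, hx, hy, LinearMap.add_apply]
    | tmul u v => simp [hTψ]
  have hinj : Function.Injective T := by
    intro a b hab
    ext q
    obtain ⟨h, rfl⟩ := hsurj q
    rw [← hTψ, ← hTψ, hab]
  -- `h` is in the image of `T`
  obtain ⟨a, ha⟩ : ∃ a : Module.Dual k E, ∀ d, a (p d) = ψ d h := by
    have h1 : (Module.Dual.eval k H h) ∘ₗ ψ.toLinearMap ∈ LinearMap.range (p : D →ₗ[k] E).dualMap := by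
      rw [LinearMap.range_dualMap_eq_dualAnnihilator_ker, Submodule.mem_dualAnnihilator]
      intro d hd
      exact hh d ((hker d).mp hd)
    obtain ⟨a, ha⟩ := h1
    exact ⟨a, fun d => congrArg (fun f => f d) ha⟩
  have hTa : T a = h := hsep _ _ fun d => by rw [hTψ, ha]
  rw [← hTa, T_main T hT hinj a (hTa ▸ hJ), map_zero]

end G

end Part_h5

section Part_h6
open TensorProduct Coalgebra HopfAlgebra WithConv
section Z
variable {k : Type*} [Field k] {H Q D : Type*}
    [Ring H] [HopfAlgebra k H] [FiniteDimensional k H]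
    [Ring Q] [HopfAlgebra k Q] [FiniteDimensional k Q]
    [Ring D] [HopfAlgebra k D] [FiniteDimensional k D]

theorem section_aux [CharZero k] [IsAlgClosed k] (π : H →ₐc[k] Q)
    (ψ : D ≃ₗ[k] Module.Dual k H)
    (hψmul : ∀ d d' : D, ψ (d * d') = convMul k H (ψ d) (ψ d'))
    (J : Ideal D) (hJr : ∀ a b, a ∈ J → a * b ∈ J)
    (A : Subalgebra k H) (hA : ∀ h, h ∈ A ↔ ∀ d ∈ J, ψ d h = 0)
    (hinj : ∀ h ∈ A, π h = 0 → h = 0) (hs : ∀ q, ∃ h ∈ A, π h = q) :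
    ∃ σ : Q →ₐc[k] H, π.comp σ = BialgHom.id k Q ∧ ∀ q : Q, σ q ∈ A := by
  let πA : A →ₐ[k] Q := (π : H →ₐ[k] Q).comp A.val
  have hb : Function.Bijective πA := by
    constructor
    · rw [injective_iff_map_eq_zero]
      intro x hx
      exact Subtype.ext (hinj x x.2 hx)
    · intro q
      obtain ⟨h, hh, hq⟩ := hs q
      exact ⟨⟨h, hh⟩, hq⟩
  let e := AlgEquiv.ofBijective πA hb
  let σ : Q →ₐ[k] H := A.val.comp (e.symm : Q →ₐ[k] A)
  have hσA : ∀ q, σ q ∈ A := fun q => (e.symm q).2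
  have hπσ : ∀ q, π (σ q) = q := fun q => e.apply_symm_apply q
  have hσπ : ∀ h ∈ A, σ (π h) = h := by
    intro h hh
    rw [← sub_eq_zero]
    refine hinj _ (A.sub_mem (hσA _) hh) ?_
    rw [map_sub, hπσ, sub_self]
  let p : H →ₗ[k] H := σ.toLinearMap ∘ₗ (π : H →ₗ[k] Q)
  have hJ : ∀ d, (∀ h ∈ A, ψ d h = 0) → d ∈ J := by
    intro d hd
    let JD : Submodule k (Module.Dual k H) := (J.restrictScalars k).map ψ.toLinearMap
    have h2 : ψ d ∈ JD := by
      rw [← Subspace.dualCoannihilator_dualAnnihilator_eq (W := JD), Submodule.mem_dualAnnihilator]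
      intro x hx
      refine hd x ((hA x).mpr fun c hc => ?_)
      exact (Submodule.mem_dualCoannihilator x).mp hx _ ⟨c, hc, rfl⟩
    obtain ⟨c, hc, hcd⟩ := h2
    rw [← ψ.injective hcd]
    exact hc
  have hdp : ∀ g : Module.Dual k H, ψ.symm (g ∘ₗ p) - ψ.symm g ∈ J := by
    intro g
    refine hJ _ fun h hh => ?_
    have : p h = h := hσπ h hh
    simp [this]
  have hp : ∀ a ∈ A, TensorProduct.map p p (comul (R := k) a) = comul (R := k) a := by
    intro a ha
    refine ev2_sep fun g => ?_
    rw [← sub_eq_zero]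
    refine (Module.forall_dual_apply_eq_zero_iff k _).mp fun g' => ?_
    rw [map_sub, sub_eq_zero]
    have h1 : ∀ X : H ⊗[k] H, g' (ev2 g X) = LinearMap.mul' k k (TensorProduct.map g' g X) := by
      intro X
      induction X with
      | zero => simp
      | add x y hx hy => simp only [map_add, hx, hy]
      | tmul u v => simp [mul_comm]
    rw [h1, h1, ← LinearMap.comp_apply (TensorProduct.map g' g), ← TensorProduct.map_comp,
      ← convMul_eq, ← convMul_eq]
    have h2 := (hA a).mp ha (ψ.symm (g' ∘ₗ p) * ψ.symm (g ∘ₗ p) - ψ.symm g' * ψ.symm g) (by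
      have : ψ.symm (g' ∘ₗ p) * ψ.symm (g ∘ₗ p) - ψ.symm g' * ψ.symm g =
        (ψ.symm (g' ∘ₗ p) - ψ.symm g') * ψ.symm (g ∘ₗ p) +
          ψ.symm g' * (ψ.symm (g ∘ₗ p) - ψ.symm g) := by noncomm_ring
      rw [this]
      exact J.add_mem (hJr _ _ (hdp _)) (J.mul_mem_left _ (hdp _)))
    rw [map_sub, hψmul, hψmul, LinearMap.sub_apply, sub_eq_zero] at h2
    simpa using h2
  refine ⟨BialgHom.ofAlgHom σ ?_ ?_, ?_, ?_⟩
  · ext q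
    have := CoalgHomClass.counit_comp_apply π (σ q)
    rw [hπσ] at this
    exact this.symm
  · ext q
    have h1 : comul (R := k) q = TensorProduct.map (π : H →ₗ[k] Q) (π : H →ₗ[k] Q)
        (comul (R := k) (σ q)) := by
      have := CoalgHomClass.map_comp_comul_apply π (σ q)
      rw [hπσ] at this
      exact this.symm
    have h2 := hp _ (hσA q)
    change TensorProduct.map σ.toLinearMap σ.toLinearMap (comul (R := k) q) = comul (R := k) (σ q)
    rw [h1, ← h2, ← LinearMap.comp_apply, ← TensorProduct.map_comp, h2]
    exact h2
  · ext q
    exact hπσ q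
  · exact hσA
end Z

end Part_h6

/-- Let `H` be a finite-dimensional Hopf algebra over a field `k` of
characteristic zero with both the Chevalley property (the Jacobson radical of `H` is a
Hopf ideal, giving the quotient Hopf algebra map `π : H → H/J`, modelled by a
surjective bialgebra map onto `Q` with kernel the Jacobson radical) and the dual
Chevalley property (the Jacobson radical of the dual Hopf algebra `H*` — modelled by a
Hopf algebra `D` identified with the dual of `H` via `ψ` — is a Hopf ideal).  Then the
composite `(H*/J_{H*})* ↪ H → H/J`, of the inclusion of the maximal semisimple
sub-Hopf-algebra `(H*/J_{H*})* = {h ∈ H | ∀ d ∈ J_{H*}, d(h) = 0}` into `H` with the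
quotient map `π`, is an isomorphism of Hopf algebras; in particular `π` admits a Hopf
algebra section. -/
theorem stmt18 {k H Q D : Type*} [Field k] [CharZero k] [IsAlgClosed k]
    [Ring H] [HopfAlgebra k H] [FiniteDimensional k H]
    [Ring Q] [HopfAlgebra k Q] [FiniteDimensional k Q]
    [Ring D] [HopfAlgebra k D] [FiniteDimensional k D]
    -- Chevalley property of `H`: the quotient Hopf algebra map onto `H/J`
    (π : H →ₐc[k] Q) (hsurj : Function.Surjective π)
    (hker : ∀ h : H, π h = 0 ↔ h ∈ Ideal.jacobson (⊥ : Ideal H))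
    -- `D` is the dual Hopf algebra `H*` of `H`, via the identification `ψ`
    (ψ : D ≃ₗ[k] Module.Dual k H)
    (hψmul : ∀ d d' : D, ψ (d * d') = convMul k H (ψ d) (ψ d'))
    (hψone : ψ 1 = Coalgebra.counit (R := k) (A := H))
    (hψcomul : ∀ (d : D) (a b : H),
      TensorProduct.dualDistrib k H H
        (TensorProduct.map ψ.toLinearMap ψ.toLinearMap (Coalgebra.comul (R := k) d))
        (a ⊗ₜ[k] b) = ψ d (a * b))
    (hψcounit : ∀ d : D, Coalgebra.counit (R := k) d = ψ d 1)
    -- dual Chevalley property: the Jacobson radical of `D ≅ H*` is a Hopf ideal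
    (hJcomul : ∀ a ∈ Submodule.restrictScalars k (Ideal.jacobson (⊥ : Ideal D)),
      Coalgebra.comul (R := k) a ∈
        LinearMap.range (TensorProduct.map
          (Submodule.restrictScalars k (Ideal.jacobson (⊥ : Ideal D))).subtype
          (LinearMap.id (R := k) (M := D))) ⊔
        LinearMap.range (TensorProduct.map (LinearMap.id (R := k) (M := D))
          (Submodule.restrictScalars k (Ideal.jacobson (⊥ : Ideal D))).subtype))
    (hJcounit : ∀ a ∈ Submodule.restrictScalars k (Ideal.jacobson (⊥ : Ideal D)),
      Coalgebra.counit (R := k) a = 0)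
    (hJantipode : ∀ a ∈ Submodule.restrictScalars k (Ideal.jacobson (⊥ : Ideal D)),
      HopfAlgebra.antipode (R := k) a ∈
        Submodule.restrictScalars k (Ideal.jacobson (⊥ : Ideal D))) :
    -- the composite `(H*/J_{H*})* ↪ H → H/J` is bijective
    Set.BijOn π {h : H | ∀ d ∈ Ideal.jacobson (⊥ : Ideal D), ψ d h = 0} Set.univ ∧
      -- in particular, `π` admits a Hopf algebra section with image `(H*/J_{H*})*`
      ∃ σ : Q →ₐc[k] H, π.comp σ = BialgHom.id k Q ∧
        ∀ q : Q, σ q ∈ {h : H | ∀ d ∈ Ideal.jacobson (⊥ : Ideal D), ψ d h = 0} := by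
  have hJr : ∀ a b, a ∈ Ideal.jacobson (⊥ : Ideal D) → a * b ∈ Ideal.jacobson (⊥ : Ideal D) :=
    fun a b ha => Ideal.mul_mem_right b _ ha
  have hH : Ideal.IsHopfIdeal k (Ideal.jacobson (⊥ : Ideal D)) := by
    have h1 : (Submodule.restrictScalars k (Ideal.jacobson (⊥ : Ideal D))).IsCoideal := by
      rw [Submodule.isCoideal_iff_comul_mem]
      refine ⟨hJcounit, fun x hx => ?_⟩
      rw [sup_comm]
      exact hJcomul x hx
    exact { h1 with antipode_mem := fun x hx => hJantipode x hx }
  have hinj : ∀ h : H, (∀ d ∈ Ideal.jacobson (⊥ : Ideal D), ψ d h = 0) → π h = 0 → h = 0 :=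
    fun h hh hπ => inj_aux
      (Bialgebra.Quotient.mkBialgHom (R := k) (Ideal.jacobson (⊥ : Ideal D)))
      Ideal.Quotient.mk_surjective (fun d => Ideal.Quotient.eq_zero_iff_mem) ψ hψcomul h hh
      ((hker h).mp hπ)
  have hs := surj_aux π hsurj hker ψ hψmul
  let A : Subalgebra k H :=
    { carrier := {h : H | ∀ d ∈ Ideal.jacobson (⊥ : Ideal D), ψ d h = 0}
      mul_mem' := by
        intro x y hx hy d hd
        rw [← hψcomul]
        let L : D ⊗[k] D →ₗ[k] k := Module.Dual.eval k (H ⊗[k] H) (x ⊗ₜ[k] y) ∘ₗ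
          TensorProduct.dualDistrib k H H ∘ₗ
            TensorProduct.map ψ.toLinearMap ψ.toLinearMap
        refine (sup_le ?_ ?_ : _ ≤ LinearMap.ker L) (hJcomul d hd)
        · rw [LinearMap.range_le_ker_iff]
          ext u v
          simp [L, hx u u.2]
        · rw [LinearMap.range_le_ker_iff]
          ext u v
          simp [L, hy v v.2]
      add_mem' := by
        intro x y hx hy d hd
        rw [map_add, hx d hd, hy d hd, add_zero]
      algebraMap_mem' := by
        intro r d hd
        rw [Algebra.algebraMap_eq_smul_one, map_smul, ← hψcounit, hJcounit d hd, smul_zero] }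
  refine ⟨⟨fun _ _ => trivial, fun x hx y hy hxy => ?_, fun q _ => ?_⟩, ?_⟩
  · rw [← sub_eq_zero]
    exact hinj _ (A.sub_mem hx hy) (by rw [map_sub, hxy, sub_self])
  · obtain ⟨h, hh, hq⟩ := hs q
    exact ⟨h, hh, hq⟩
  · exact section_aux π ψ hψmul (Ideal.jacobson (⊥ : Ideal D)) hJr A (fun h => Iff.rfl)
      (fun h hh => hinj h hh) hs
end
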